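/- arXiv:2310.08978 — 2 statements merged into one kernel-verified Lean document; each statement's English description precedes it below -/
import Mathlib

section
/- Under the hypotheses of the main theorem, if for some index i there exist positive integers c, d such that p(m_i n + c) ≡ 0 (mod d) for all n ≥ 0, where p is the ordinary partition function, then P(A; m_i n + a_i c) ≡ 0 (mod d) for all n ≥ 0. -/
open scoped Classical

/-- Number of partitions of `n` whose part multiplicities all lie in `A`. -/
noncomputable def partP (A : Set ℕ) (n : ℕ) : ℕ :=
  (Finset.univ.filter (fun p : Nat.Partition n =>
    ∀ i ∈ p.parts, Multiset.count i p.parts ∈ A)).card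

/-- Number of partitions of `n` whose parts all lie in `B`. -/
noncomputable def partQ (B : Set ℕ) (n : ℕ) : ℕ :=
  (Finset.univ.filter (fun p : Nat.Partition n => ∀ i ∈ p.parts, i ∈ B)).card

open PowerSeries in
/-- The generating function of the number of partitions. -/
noncomputable def partitionSeries (R : Type*) [CommSemiring R] : PowerSeries R :=
  PowerSeries.mk fun n => (Fintype.card (Nat.Partition n) : R)

section GeneratingFunctions

open PowerSeries PowerSeries.WithPiTopology

lemma coeff_genFun_indicator (A : Set ℕ) (n : ℕ) :
    (Nat.Partition.genFun fun _ j => if j ∈ A then (1 : ℤ) else 0).coeff n = partP A n := by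
  simp only [Nat.Partition.coeff_genFun, Finsupp.prod, partP, Finset.card_filter, Nat.cast_sum,
    Finset.prod_ite_zero]
  refine Finset.sum_congr rfl fun p _ => ?_
  simp

lemma genFun_one : (Nat.Partition.genFun fun _ _ => (1 : ℤ)) = partitionSeries ℤ := by
  ext n
  simp [Finsupp.prod, partitionSeries]

lemma hasProd_expand_mk (a : ℕ → ℤ) (ha : a 0 = 1) :
    HasProd (fun i : ℕ => expand (i + 1) i.succ_ne_zero (PowerSeries.mk a))
      (Nat.Partition.genFun fun _ j => a j) := by
  suffices h : ∀ i : ℕ, expand (i + 1) i.succ_ne_zero (PowerSeries.mk a) =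
      1 + ∑' j, a (j + 1) • X ^ ((i + 1) * (j + 1)) by
    simp only [h]
    exact Nat.Partition.hasProd_genFun fun _ j => a j
  intro i
  have h := hasSum_of_monomials_self (expand (i + 1) i.succ_ne_zero (PowerSeries.mk a))
  have hinj : Function.Injective fun j : ℕ => (i + 1) * j :=
    fun x y hxy => Nat.eq_of_mul_eq_mul_left i.succ_pos hxy
  rw [← hinj.hasSum_iff] at h
  · rw [← h.tsum_eq, h.summable.tsum_eq_zero_add]
    simp [coeff_expand_mul, ha, monomial_eq_C_mul_X_pow]
  · rintro x hx
    rw [coeff_expand_of_not_dvd, map_zero]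
    rintro ⟨y, rfl⟩
    exact hx ⟨y, rfl⟩

lemma hasProd_expand_one_sub (r : ℕ) (hr : r ≠ 0) :
    HasProd (fun i : ℕ => expand (i + 1) i.succ_ne_zero (1 - X ^ r : PowerSeries ℤ))
      (expand r hr (pentagonalSeries ℤ)) := by
  have hc : Continuous (expand r hr : PowerSeries ℤ → PowerSeries ℤ) := by
    refine continuous_pi fun d => ?_
    obtain ⟨k, rfl⟩ : ∃ k, d = Finsupp.single () k := ⟨d (), by ext; simp⟩
    by_cases hk : r ∣ k
    · obtain ⟨k, rfl⟩ := hk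
      exact (continuous_coeff ℤ k).congr fun φ => (coeff_expand_mul r hr φ k).symm
    · exact continuous_const.congr fun φ => (coeff_expand_of_not_dvd r hr φ hk).symm
  convert (hasProd_one_sub_X_pow ℤ).map (expand r hr) hc using 2 with i
  simp [← pow_mul, mul_comm]

lemma pentagonalSeries_mul_partitionSeries :
    pentagonalSeries ℤ * partitionSeries ℤ = 1 := by
  have h := (hasProd_expand_one_sub 1 one_ne_zero).mul (hasProd_expand_mk (fun _ => 1) rfl)
  simp only [expand_one_apply, genFun_one] at h
  refine h.unique ?_
  convert hasProd_one with i
  rw [← map_mul, mul_comm, pow_one]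
  exact (congrArg _ (mk_one_mul_one_sub_eq_one ℤ)).trans (map_one _)

/-- If `A` is stable under shifts by `r` away from multiples of `M`, the generating function of
`partP A` is the dilated partition series times a series in `X ^ M`. -/
lemma coeff_genFun_mul_expand (A : Set ℕ) (r M : ℕ) (hr : r ≠ 0) (h0 : 0 ∈ A)
    (hA : ∀ x, ¬ M ∣ x → (x ∈ A ↔ r ≤ x ∧ x - r ∈ A)) (hM : M ≠ 0) (k : ℕ) (hk : ¬ M ∣ k) :
    ((Nat.Partition.genFun fun _ j => if j ∈ A then (1 : ℤ) else 0) *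
      expand r hr (pentagonalSeries ℤ)).coeff k = 0 := by
  set a : ℕ → ℤ := fun j => if j ∈ A then 1 else 0
  have hH : ∃ H : PowerSeries ℤ, PowerSeries.mk a * (1 - X ^ r) = expand M hM H := by
    refine ⟨PowerSeries.mk fun n => (PowerSeries.mk a * (1 - X ^ r)).coeff (M * n), ?_⟩
    ext n
    by_cases hn : M ∣ n
    · obtain ⟨n, rfl⟩ := hn
      rw [coeff_expand_mul, coeff_mk]
    · rw [coeff_expand_of_not_dvd _ _ _ hn, mul_sub, mul_one, map_sub, coeff_mul_X_pow']
      have := hA n hn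
      simp only [coeff_mk, a]
      grind
  obtain ⟨H, hH⟩ := hH
  have h := (hasProd_expand_mk a (by simp [a, h0])).mul (hasProd_expand_one_sub r hr)
  simp only [← map_mul, hH] at h
  have hcoeff := ((continuous_coeff ℤ k).tendsto _).comp h
  refine tendsto_nhds_unique hcoeff (tendsto_const_nhds.congr fun s => ?_)
  have : ∀ i : ℕ, expand (i + 1) i.succ_ne_zero (expand M hM H) =
      expand M hM (expand (i + 1) i.succ_ne_zero H) := fun i => by
    rw [← expand_mul, ← expand_mul]
    simp [mul_comm]
  simp only [Function.comp_apply, this, ← map_prod, coeff_expand_of_not_dvd _ _ _ hk]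

lemma dvd_partP (A : Set ℕ) (r M : ℕ) (hr : r ≠ 0) (h0 : 0 ∈ A)
    (hA : ∀ x, ¬ M ∣ x → (x ∈ A ↔ r ≤ x ∧ x - r ∈ A)) (hM : M ≠ 0) (d N : ℕ)
    (hd : ∀ u, r * u ≡ N [MOD M] → d ∣ Fintype.card (Nat.Partition u)) : d ∣ partP A N := by
  set G := Nat.Partition.genFun fun _ j => if j ∈ A then (1 : ℤ) else 0 with hG
  have hfac : G = (G * expand r hr (pentagonalSeries ℤ)) * expand r hr (partitionSeries ℤ) := by
    rw [mul_assoc, ← map_mul, pentagonalSeries_mul_partitionSeries, map_one, mul_one]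
  rw [← Int.natCast_dvd_natCast, ← coeff_genFun_indicator, ← hG, hfac, coeff_mul]
  refine Finset.dvd_sum fun ⟨x, y⟩ hxy => ?_
  rw [Finset.HasAntidiagonal.mem_antidiagonal] at hxy
  simp only at hxy
  by_cases hx : M ∣ x
  · by_cases hy : r ∣ y
    · obtain ⟨u, rfl⟩ := hy
      refine Dvd.dvd.mul_left ?_ _
      rw [coeff_expand_mul, partitionSeries, coeff_mk]
      refine Int.natCast_dvd_natCast.2 (hd u ?_)
      rw [← hxy, Nat.modEq_iff_dvd' (by omega)]
      simpa using hx
    · simp [coeff_expand_of_not_dvd _ _ _ hy]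
  · rw [hG, coeff_genFun_mul_expand A r M hr h0 hA hM x hx]
    simp

end GeneratingFunctions

section Transcendence

open PowerSeries

lemma exists_relation_of_isAlgebraic {R S : Type*} [CommRing R] [IsDomain R] [CommRing S]
    [IsDomain S] [Algebra R S] [FaithfulSMul R S] {x : S} (hx : IsAlgebraic R x) (e : ℕ → ℕ) :
    ∃ (h : ℕ) (g : Fin h → R), ∑ i, g i • x ^ e i = 0 ∧ ∃ i, g i ≠ 0 := by
  let L := FractionRing S
  let K := FractionRing R
  have : FaithfulSMul R L := FaithfulSMul.trans R S L
  let : Algebra K L := FractionRing.liftAlgebra R L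
  have : IsScalarTower R K L := FractionRing.isScalarTower_liftAlgebra R L
  have hxL : IsAlgebraic R (algebraMap S L x) := hx.algebraMap
  have hxK : IsAlgebraic K (algebraMap S L x) := hxL.extendScalars (IsFractionRing.injective R K)
  have hfin : FiniteDimensional K (IntermediateField.adjoin K {algebraMap S L x}) :=
    IntermediateField.adjoin.finiteDimensional hxK.isIntegral
  set V := IntermediateField.adjoin K {algebraMap S L x}
  let y : V := ⟨algebraMap S L x, IntermediateField.mem_adjoin_simple_self K _⟩
  set h := Module.finrank K V + 1 with hh
  have hdep : ¬ LinearIndependent K fun i : Fin h => y ^ e i := fun hli => by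
    have := hli.fintype_card_le_finrank
    simp [hh] at this
  have hdepR : ¬ LinearIndependent R fun i : Fin h => x ^ e i := fun hli => hdep <| by
    have h1 : LinearIndependent R fun i : Fin h => algebraMap S L (x ^ e i) :=
      hli.map' (Algebra.linearMap S L |>.restrictScalars R)
        (LinearMap.ker_eq_bot.2 (IsFractionRing.injective S L))
    rw [LinearIndependent.iff_fractionRing R K] at h1
    refine LinearIndependent.of_comp V.val.toLinearMap ?_
    have hcomp : (V.val.toLinearMap ∘ fun i : Fin h => y ^ e i) =
        fun i : Fin h => algebraMap S L (x ^ e i) := by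
      ext i
      simp [y]
    rw [hcomp]
    exact h1
  obtain ⟨g, hg, i, hi⟩ := Fintype.not_linearIndependent_iff.1 hdepR
  exact ⟨h, g, hg, i, hi⟩

lemma zmod_pow_prime_pow (p : ℕ) [Fact p.Prime] (f : PowerSeries (ZMod p)) (n : ℕ) :
    f ^ p ^ n = expand (p ^ n) (pow_ne_zero n (Fact.out : p.Prime).ne_zero) f := by
  have hp := (Fact.out : p.Prime).ne_zero
  have h1 : ∀ f : PowerSeries (ZMod p), f ^ p = expand p hp f := fun f => by
    have := MvPowerSeries.map_frobenius_expand p hp (f := f)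
    rw [← this, ZMod.frobenius_zmod]
    exact congrFun (congrArg DFunLike.coe MvPowerSeries.map_id) _
  induction n with
  | zero => simp
  | succ n ih =>
    simp only [pow_succ', mul_comm p, pow_mul, ih, h1, ← expand_mul]

lemma pentagonal_relation {p : ℕ} (hp : p.Prime) {i₀ i : ℕ} (hi : i₀ ≤ i) {k k' : ℤ} {B : ℤ}
    {t₀ t : ℤ} (hpk : (p : ℤ) ∣ k) (hk : B < k) (hB : 0 ≤ B)
    (hBt : |24 * (t₀ - t) + (p ^ 2) ^ i - (p ^ 2) ^ i₀| ≤ B)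
    (h : ((p : ℤ) ^ 2) ^ i * pentagonal k' + t = (p ^ 2) ^ i₀ * pentagonal k + t₀) :
    i = i₀ ∧ t = t₀ := by
  have e1 := two_mul_natCast_pentagonal k
  have e2 := two_mul_natCast_pentagonal k'
  set a : ℤ := p ^ i * (6 * k' - 1) with ha
  set b : ℤ := p ^ i₀ * (6 * k - 1) with hb
  have hab : a ^ 2 - b ^ 2 = 24 * (t₀ - t) + (p ^ 2) ^ i - (p ^ 2) ^ i₀ := by
    rw [ha, hb, mul_pow, mul_pow, ← pow_mul, ← pow_mul, mul_comm i, mul_comm i₀, pow_mul, pow_mul]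
    linear_combination 24 * h - ((p : ℤ) ^ 2) ^ i * 12 * e2 + ((p : ℤ) ^ 2) ^ i₀ * 12 * e1
  rw [← hab] at hBt
  have hp0 : (0 : ℤ) < p := by exact_mod_cast hp.pos
  have hbk : B < b := by
    have : (1 : ℤ) ≤ p ^ i₀ := one_le_pow₀ (by omega)
    rw [hb]
    nlinarith
  have habs : a = b ∨ a = -b := by
    rw [← sq_eq_sq_iff_eq_or_eq_neg]
    by_contra hne
    have h1 : |a| ≠ |b| := fun h => hne (sq_eq_sq_iff_abs_eq_abs a b |>.2 h)
    rw [← sq_abs a, ← sq_abs b, sq_sub_sq, abs_mul] at hBt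
    have h2 : 1 ≤ |(|a| - |b|)| := Int.one_le_abs (sub_ne_zero.2 h1)
    have h3 : |b| ≤ |(|a| + |b|)| := le_trans (by linarith [abs_nonneg a]) (le_abs_self _)
    have h4 : b ≤ |b| := le_abs_self b
    nlinarith
  have hsq : a ^ 2 = b ^ 2 := sq_eq_sq_iff_eq_or_eq_neg.2 habs
  have hii : i = i₀ := by
    by_contra hne
    have hlt : i₀ < i := lt_of_le_of_ne hi (Ne.symm hne)
    obtain ⟨j, rfl⟩ := Nat.exists_eq_add_of_lt hlt
    have hdvd : (p : ℤ) ∣ 6 * k - 1 := by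
      have hpi : (p : ℤ) ^ i₀ ≠ 0 := pow_ne_zero _ hp0.ne'
      rw [ha, hb] at habs
      rcases habs with h' | h'
      · have : (p : ℤ) ^ (j + 1) * (6 * k' - 1) = 6 * k - 1 :=
          mul_left_cancel₀ hpi (by rw [← h']; ring)
        exact ⟨p ^ j * (6 * k' - 1), by rw [← this]; ring⟩
      · have : (p : ℤ) ^ (j + 1) * (6 * k' - 1) = -(6 * k - 1) :=
          mul_left_cancel₀ hpi (by rw [mul_neg, ← h']; ring)
        exact ⟨-(p ^ j * (6 * k' - 1)), by linear_combination this⟩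
    have h1 : (p : ℤ) ∣ 1 := by
      have := dvd_sub (hpk.mul_left 6) hdvd
      simpa using this
    have := Int.le_of_dvd one_pos h1
    have := hp.two_le
    omega
  subst hii
  refine ⟨rfl, ?_⟩
  rw [hsq] at hab
  linarith

lemma transcendental_pentagonalSeries (p : ℕ) [hp : Fact p.Prime] :
    Transcendental (Polynomial (ZMod p)) (pentagonalSeries (ZMod p)) := by
  intro halg
  have : FaithfulSMul (Polynomial (ZMod p)) (PowerSeries (ZMod p)) :=
    (faithfulSMul_iff_algebraMap_injective _ _).2 (Polynomial.coe_injective _)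
  obtain ⟨h, g, hg, hne⟩ := exists_relation_of_isAlgebraic halg fun i => p ^ (2 * i)
  simp only [zmod_pow_prime_pow] at hg
  obtain ⟨i₀, hi₀, hmin⟩ : ∃ i₀, g i₀ ≠ 0 ∧ ∀ i, g i ≠ 0 → i₀ ≤ i := by
    obtain ⟨i₀, h₀, hm⟩ := (Finset.univ.filter fun i => g i ≠ 0).exists_minimal
      (by obtain ⟨i, hi⟩ := hne; exact ⟨i, by simpa using hi⟩)
    simp only [Finset.mem_filter, Finset.mem_univ, true_and] at h₀ hm
    exact ⟨i₀, h₀, fun i hi => (le_total i₀ i).elim id fun hle => hm hi hle⟩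
  set D := ∑ i, (g i).natDegree with hD
  have hdeg : ∀ i, (g i).natDegree ≤ D := fun i =>
    Finset.single_le_sum (f := fun i => (g i).natDegree) (fun _ _ => Nat.zero_le _)
      (Finset.mem_univ i)
  set t₀ := (g i₀).natDegree with ht₀
  set B : ℤ := 24 * D + (p ^ 2) ^ h with hBdef
  have hp1 : (1 : ℤ) ≤ p := by exact_mod_cast hp.out.one_lt.le
  have hB : 0 ≤ B := by positivity
  set k : ℤ := p * (B + 1) with hk
  set n := (p ^ 2) ^ (i₀ : ℕ) * pentagonal k + t₀ with hn
  have hcoeff_alg : ∀ (f : Polynomial (ZMod p)) (t : ℕ),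
      coeff t (algebraMap (Polynomial (ZMod p)) (PowerSeries (ZMod p)) f) = f.coeff t :=
    fun f t => Polynomial.coeff_coe f t
  have hdom : ∀ (i : Fin h) (t s : ℕ), t + s = n → (g i).coeff t ≠ 0 →
      coeff s (expand (p ^ (2 * (i : ℕ))) (pow_ne_zero _ hp.out.ne_zero)
        (pentagonalSeries (ZMod p))) ≠ 0 → (i : ℕ) = i₀ ∧ (t : ℤ) = t₀ := by
    intro i t s hts ht hs
    have hile : i₀ ≤ i := hmin i fun h0 => ht (by simp [h0])
    rw [coeff_expand] at hs
    split_ifs at hs with hdvd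
    · obtain ⟨s, rfl⟩ := hdvd
      rw [Nat.mul_div_cancel_left _ (by have := hp.out.pos; positivity), Ne,
        coeff_pentagonalSeries_eq_zero_iff, not_not] at hs
      obtain ⟨k', rfl⟩ := hs
      have htD : t ≤ D := (Polynomial.le_natDegree_of_ne_zero ht).trans (hdeg i)
      have ht₀D : t₀ ≤ D := hdeg i₀
      refine pentagonal_relation hp.out hile (B := B) (k := k) (k' := k') ⟨_, rfl⟩ ?_ hB ?_ ?_
      · rw [hk]
        nlinarith
      · have hpow : ∀ j : Fin h, (1 : ℤ) ≤ (p ^ 2) ^ (j : ℕ) ∧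
            ((p : ℤ) ^ 2) ^ (j : ℕ) ≤ (p ^ 2) ^ h := fun j =>
          ⟨one_le_pow₀ (one_le_pow₀ hp1), pow_le_pow_right₀ (one_le_pow₀ hp1) j.2.le⟩
        rw [hBdef, abs_le]
        have h1 := hpow i
        have h2 := hpow i₀
        constructor <;> omega
      · rw [hn, pow_mul] at hts
        zify at hts
        linarith
    · exact absurd rfl hs
  have hcoeff := congrArg (coeff n) hg
  rw [map_sum, map_zero, Finset.sum_eq_single i₀] at hcoeff
  · rw [Algebra.smul_def, coeff_mul,
      Finset.sum_eq_single (t₀, (p ^ 2) ^ (i₀ : ℕ) * pentagonal k)] at hcoeff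
    · simp only [← pow_mul, coeff_expand_mul, hcoeff_alg] at hcoeff
      refine (mul_ne_zero (Polynomial.leadingCoeff_ne_zero.2 hi₀) ?_) hcoeff
      rw [Ne, coeff_pentagonalSeries_eq_zero_iff, not_not]
      exact ⟨k, rfl⟩
    · rintro ⟨t, s⟩ hts hne'
      rw [Finset.HasAntidiagonal.mem_antidiagonal] at hts
      by_contra hmul
      rw [← Ne, mul_ne_zero_iff, hcoeff_alg] at hmul
      have := (hdom i₀ t s hts hmul.1 hmul.2).2
      simp only [ne_eq, Prod.mk.injEq, not_and] at hne' hts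
      omega
    · intro h'
      exact absurd (by rw [Finset.HasAntidiagonal.mem_antidiagonal, hn]; ring) h'
  · intro i _ hi
    rw [Algebra.smul_def, coeff_mul]
    refine Finset.sum_eq_zero ?_
    rintro ⟨t, s⟩ hts
    rw [Finset.HasAntidiagonal.mem_antidiagonal] at hts
    by_contra hmul
    rw [← Ne, mul_ne_zero_iff, hcoeff_alg] at hmul
    exact hi (Fin.ext (hdom i t s hts hmul.1 hmul.2).1)
  · simp

end Transcendence

section Expansions

open PowerSeries PowerSeries.WithPiTopology Filter Topology

/-- The power series `A` converges to `u` on the open unit disc. -/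
def HasExpansion (A : PowerSeries ℂ) (u : ℂ → ℂ) : Prop :=
  ∀ q : ℂ, ‖q‖ < 1 → HasSum (fun n => coeff n A * q ^ n) (u q)

namespace HasExpansion

variable {A B : PowerSeries ℂ} {u v : ℂ → ℂ}

lemma congr (hA : HasExpansion A u) (h : ∀ q, ‖q‖ < 1 → u q = v q) : HasExpansion A v :=
  fun q hq => h q hq ▸ hA q hq

lemma const (a : ℂ) : HasExpansion (C a) fun _ => a := fun q _ => by
  convert hasSum_ite_eq 0 a using 2 with n
  rw [coeff_C]
  split_ifs with h <;> simp [h]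

lemma X_pow (k : ℕ) : HasExpansion (X ^ k) fun q => q ^ k := fun q _ => by
  convert hasSum_ite_eq k (q ^ k) using 2 with n
  rw [coeff_X_pow]
  split_ifs with h <;> simp [h]

lemma add (hA : HasExpansion A u) (hB : HasExpansion B v) :
    HasExpansion (A + B) fun q => u q + v q := fun q hq => by
  simpa [add_mul] using (hA q hq).add (hB q hq)

lemma mul (hA : HasExpansion A u) (hB : HasExpansion B v) :
    HasExpansion (A * B) fun q => u q * v q := fun q hq => by
  have h1 := (hA q hq).summable.norm
  have h2 := (hB q hq).summable.norm
  have h := (summable_norm_sum_mul_antidiagonal_of_summable_norm h1 h2).of_norm.hasSum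
  rw [← tsum_mul_tsum_eq_tsum_sum_antidiagonal_of_summable_norm h1 h2, (hA q hq).tsum_eq,
    (hB q hq).tsum_eq] at h
  refine h.congr_fun ?_
  intro n
  rw [coeff_mul, Finset.sum_mul]
  refine Finset.sum_congr rfl fun x hx => ?_
  rw [← Finset.HasAntidiagonal.mem_antidiagonal.1 hx, pow_add]
  ring

lemma C_mul (hA : HasExpansion A u) (a : ℂ) : HasExpansion (C a * A) fun q => a * u q :=
  (const a).mul hA

lemma pow (hA : HasExpansion A u) (k : ℕ) : HasExpansion (A ^ k) fun q => u q ^ k := by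
  induction k with
  | zero => simpa using const 1
  | succ k ih => simpa [pow_succ] using ih.mul hA

lemma sum {ι : Type*} (s : Finset ι) {A : ι → PowerSeries ℂ} {u : ι → ℂ → ℂ}
    (h : ∀ i ∈ s, HasExpansion (A i) (u i)) :
    HasExpansion (∑ i ∈ s, A i) fun q => ∑ i ∈ s, u i q := fun q hq => by
  simpa [Finset.sum_mul] using hasSum_sum fun i hi => h i hi q hq

lemma prod {ι : Type*} (s : Finset ι) {A : ι → PowerSeries ℂ} {u : ι → ℂ → ℂ}
    (h : ∀ i ∈ s, HasExpansion (A i) (u i)) :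
    HasExpansion (∏ i ∈ s, A i) fun q => ∏ i ∈ s, u i q := by
  induction s using Finset.induction_on with
  | empty => simpa using const 1
  | insert i s hi ih =>
    simp only [Finset.prod_insert hi]
    exact (h i (by simp)).mul (ih fun j hj => h j (by simp [hj]))

lemma expand (hA : HasExpansion A u) {k : ℕ} (hk : k ≠ 0) :
    HasExpansion (PowerSeries.expand k hk A) fun q => u (q ^ k) := fun q hq => by
  have hinj : Function.Injective fun j : ℕ => k * j :=
    fun x y hxy => Nat.eq_of_mul_eq_mul_left (Nat.pos_of_ne_zero hk) hxy
  rw [← hinj.hasSum_iff]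
  · have := hA (q ^ k) (by rw [norm_pow]; exact pow_lt_one₀ (norm_nonneg _) hq hk)
    simpa [Function.comp_def, coeff_expand_mul, pow_mul] using this
  · rintro x hx
    rw [coeff_expand_of_not_dvd, zero_mul]
    rintro ⟨y, rfl⟩
    exact hx ⟨y, rfl⟩

lemma rescale (hA : HasExpansion A u) {ζ : ℂ} (hζ : ‖ζ‖ = 1) :
    HasExpansion (PowerSeries.rescale ζ A) fun q => u (ζ * q) := fun q hq => by
  have := hA (ζ * q) (by simpa [hζ] using hq)
  simpa [coeff_rescale, mul_pow, mul_assoc, mul_left_comm] using this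

lemma hasFPowerSeriesAt (hA : HasExpansion A u) :
    HasFPowerSeriesAt u (FormalMultilinearSeries.ofScalars ℂ fun n => coeff n A) 0 := by
  rw [hasFPowerSeriesAt_iff]
  filter_upwards [Metric.ball_mem_nhds (0 : ℂ) one_pos] with q hq
  simpa [mul_comm] using hA q (by simpa using hq)

lemma coeff_eq (hA : HasExpansion A u) (n : ℕ) : coeff n A = iteratedDeriv n u 0 / n.factorial := by
  have h := hA.hasFPowerSeriesAt
  have := congrArg (fun p => FormalMultilinearSeries.coeff p n)
    (h.eq_formalMultilinearSeries h.analyticAt.hasFPowerSeriesAt)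
  simpa using this

lemma unique (hA : HasExpansion A u) (hB : HasExpansion B u) : A = B := by
  ext n
  rw [hA.coeff_eq, hB.coeff_eq]

lemma isBigO (hA : HasExpansion A u) {D : ℕ} (h : ∀ n < D, coeff n A = 0) :
    u =O[𝓝 0] fun q => ‖q‖ ^ D := by
  have := hA.hasFPowerSeriesAt.isBigO_sub_partialSum_pow D
  simp only [zero_add] at this
  refine this.congr_left fun q => ?_
  rw [FormalMultilinearSeries.partialSum, Finset.sum_eq_zero, sub_zero]
  intro n hn
  simp [FormalMultilinearSeries.ofScalars, h n (Finset.mem_range.1 hn)]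

lemma exists_of_differentiableOn (hu : DifferentiableOn ℂ u (Metric.ball 0 1)) :
    ∃ A, HasExpansion A u := by
  refine ⟨PowerSeries.mk fun n => iteratedDeriv n u 0 / n.factorial, fun q hq => ?_⟩
  refine (Complex.hasSum_taylorSeries_on_ball hu (z := q) (by simpa using hq)).congr_fun fun n => ?_
  rw [coeff_mk, sub_zero, smul_eq_mul, smul_eq_mul]
  ring

end HasExpansion

lemma tendstoLocallyUniformlyOn_iteratedDeriv {ι : Type*} {φ : Filter ι} [φ.NeBot]
    {F : ι → ℂ → ℂ} {f : ℂ → ℂ} {U : Set ℂ} (hf : TendstoLocallyUniformlyOn F f φ U)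
    (hF : ∀ i, Differentiable ℂ (F i)) (hU : IsOpen U) (k : ℕ) :
    TendstoLocallyUniformlyOn (fun i => iteratedDeriv k (F i)) (iteratedDeriv k f) φ U := by
  induction k with
  | zero => simpa using hf
  | succ k ih =>
    simp_rw [iteratedDeriv_succ]
    refine ih.deriv (.of_forall fun i => ?_) hU
    exact ((hF i).contDiff (n := ⊤).differentiable_iteratedDeriv k
      (by exact_mod_cast WithTop.coe_lt_top _)).differentiableOn

/-- The Euler product `∏ (1 - q ^ (n + 1))`. -/
noncomputable def eulerProd (q : ℂ) : ℂ := ∏' n : ℕ, (1 - q ^ (n + 1))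

lemma differentiableOn_eulerProd : DifferentiableOn ℂ eulerProd (Metric.ball 0 1) :=
  ModularForm.differentiableOn_tprod_one_sub_pow

lemma eulerProd_ne_zero {q : ℂ} (hq : ‖q‖ < 1) : eulerProd q ≠ 0 := by
  refine tprod_one_add_ne_zero_of_summable (f := fun n => -q ^ (n + 1)) (fun i => ?_) ?_
  · rw [← sub_eq_add_neg, sub_ne_zero]
    intro h
    have := pow_lt_one₀ (norm_nonneg q) hq i.succ_ne_zero
    rw [← norm_pow, ← h, norm_one] at this
    exact lt_irrefl _ this
  · simpa using (summable_nat_add_iff 1).mpr (summable_geometric_of_lt_one (norm_nonneg _) hq)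

lemma hasExpansion_eulerProd : HasExpansion (pentagonalSeries ℂ) eulerProd := by
  obtain ⟨A, hA⟩ := HasExpansion.exists_of_differentiableOn differentiableOn_eulerProd
  suffices A = pentagonalSeries ℂ from this ▸ hA
  have hfin : ∀ s : Finset ℕ, HasExpansion (∏ n ∈ s, (1 - X ^ (n + 1)))
      fun q => ∏ n ∈ s, (1 - q ^ (n + 1)) := fun s => by
    refine HasExpansion.prod s fun n _ => ?_
    simpa [sub_eq_add_neg] using
      (HasExpansion.const 1).add ((HasExpansion.X_pow (n + 1)).C_mul (-1))
  ext n
  have h1 := (WithPiTopology.continuous_coeff ℂ n).continuousAt.tendsto.comp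
    (WithPiTopology.hasProd_one_sub_X_pow ℂ)
  rw [SummationFilter.unconditional_filter] at h1
  refine tendsto_nhds_unique ?_ h1
  have h2 := (ModularForm.multipliableLocallyUniformlyOn_one_sub_pow.hasProdLocallyUniformlyOn)
  rw [hasProdLocallyUniformlyOn_iff_tendstoLocallyUniformlyOn] at h2
  have h3 := (tendstoLocallyUniformlyOn_iteratedDeriv h2 (fun s => by fun_prop)
    Metric.isOpen_ball n).tendsto_at
    (a := 0) (by simp)
  rw [hA.coeff_eq]
  refine (h3.div_const _).congr fun s => ?_
  simp only [Function.comp_apply]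
  rw [(hfin s).coeff_eq]

lemma map_pentagonalSeries {R S : Type*} [CommRing R] [CommRing S] (f : R →+* S) :
    PowerSeries.map f (pentagonalSeries R) = pentagonalSeries S := by
  ext n
  by_cases h : n ∈ Set.range pentagonal
  · obtain ⟨k, rfl⟩ := h
    simp [coeff_pentagonalSeries_pentagonal]
  · simp [coeff_pentagonalSeries_eq_zero, h]

lemma hasExpansion_inv_eulerProd : HasExpansion (partitionSeries ℂ) fun q => (eulerProd q)⁻¹ := by
  obtain ⟨A, hA⟩ := HasExpansion.exists_of_differentiableOn (u := fun q => (eulerProd q)⁻¹)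
    (differentiableOn_eulerProd.inv fun q hq => eulerProd_ne_zero (by simpa using hq))
  have h1 : pentagonalSeries ℂ * A = 1 := by
    have h2 : HasExpansion 1 fun _ => 1 := by simpa using HasExpansion.const 1
    exact ((hasExpansion_eulerProd.mul hA).congr fun q hq =>
      mul_inv_cancel₀ (eulerProd_ne_zero hq)).unique h2
  have h2 : pentagonalSeries ℂ * partitionSeries ℂ = 1 := by
    have := congrArg (PowerSeries.map (Int.castRingHom ℂ)) pentagonalSeries_mul_partitionSeries
    rw [map_mul, map_one] at this
    convert this using 2
    · rw [map_pentagonalSeries]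
    · ext n; simp [partitionSeries]
  rwa [← (isUnit_iff_exists_inv.2 ⟨_, h2⟩).mul_left_cancel (h1.trans h2.symm)]

end Expansions

section ModularFunctions

open UpperHalfPlane ModularForm Filter Topology MatrixGroups Manifold Asymptotics

/-- Holomorphic functions on `ℍ` with finitely many `SL(2, ℤ)`-translates, each of them
meromorphic at `i∞`. These are the modular functions of finite level without poles in `ℍ`. -/
structure IsModularFunction (f : ℍ → ℂ) : Prop where
  mdiff : MDiff f
  finite : (Set.range fun γ : SL(2, ℤ) => fun z : ℍ => f (γ • z)).Finite
  growth : ∀ γ : SL(2, ℤ), ∃ C : ℝ, 0 ≤ C ∧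
    (fun z : ℍ => f (γ • z)) =O[atImInfty] fun z => Real.exp (C * z.im)

lemma exp_isBigO_exp_atImInfty {a b : ℝ} (h : a ≤ b) :
    (fun z : ℍ => Real.exp (a * z.im)) =O[atImInfty] fun z => Real.exp (b * z.im) :=
  .of_bound 1 <| .of_forall fun z => by
    simpa using mul_le_mul_of_nonneg_right h z.im_pos.le

lemma one_isBigO_exp_atImInfty {b : ℝ} (h : 0 ≤ b) :
    (fun _ : ℍ => (1 : ℝ)) =O[atImInfty] fun z => Real.exp (b * z.im) := by
  simpa using exp_isBigO_exp_atImInfty h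

namespace IsModularFunction

variable {f g : ℍ → ℂ}

lemma const (a : ℂ) : IsModularFunction fun _ => a where
  mdiff := mdifferentiable_const
  finite := (Set.finite_singleton (fun _ : ℍ => a)).subset (by rintro _ ⟨γ, rfl⟩; rfl)
  growth γ := ⟨0, le_rfl, by simpa using isBigO_const_const a (one_ne_zero (α := ℝ)) _⟩

lemma add (hf : IsModularFunction f) (hg : IsModularFunction g) :
    IsModularFunction fun z => f z + g z where
  mdiff := hf.mdiff.add hg.mdiff
  finite := (Set.Finite.image2 (· + ·) hf.finite hg.finite).subset <| by
    rintro _ ⟨γ, rfl⟩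
    exact ⟨_, ⟨γ, rfl⟩, _, ⟨γ, rfl⟩, rfl⟩
  growth γ := by
    obtain ⟨a, ha, h1⟩ := hf.growth γ
    obtain ⟨b, hb, h2⟩ := hg.growth γ
    exact ⟨max a b, ha.trans (le_max_left _ _),
      (h1.trans (exp_isBigO_exp_atImInfty (le_max_left _ _))).add
        (h2.trans (exp_isBigO_exp_atImInfty (le_max_right _ _)))⟩

lemma mul (hf : IsModularFunction f) (hg : IsModularFunction g) :
    IsModularFunction fun z => f z * g z where
  mdiff := hf.mdiff.mul hg.mdiff
  finite := (Set.Finite.image2 (· * ·) hf.finite hg.finite).subset <| by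
    rintro _ ⟨γ, rfl⟩
    exact ⟨_, ⟨γ, rfl⟩, _, ⟨γ, rfl⟩, rfl⟩
  growth γ := by
    obtain ⟨a, ha, h1⟩ := hf.growth γ
    obtain ⟨b, hb, h2⟩ := hg.growth γ
    exact ⟨a + b, add_nonneg ha hb, by simpa [add_mul, Real.exp_add] using h1.mul h2⟩

lemma sum {ι : Type*} (s : Finset ι) {f : ι → ℍ → ℂ} (h : ∀ i ∈ s, IsModularFunction (f i)) :
    IsModularFunction fun z => ∑ i ∈ s, f i z := by
  induction s using Finset.induction_on with
  | empty => simpa using const 0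
  | insert i s hi ih =>
    simp only [Finset.sum_insert hi]
    exact (h i (by simp)).add (ih fun j hj => h j (by simp [hj]))

lemma of_pow {n : ℕ} (hn : 0 < n) (hf : MDiff f) (h0 : ∀ z, f z ≠ 0)
    (h : IsModularFunction fun z => f z ^ n) : IsModularFunction f where
  mdiff := hf
  finite := by
    refine (h.finite.biUnion (t := fun w =>
      {u : ℍ → ℂ | Continuous u ∧ (∀ z, u z ≠ 0) ∧ (fun z => u z ^ n) = w}) fun w _ => ?_).subset ?_
    · by_cases hne : ∃ u₀ : ℍ → ℂ, Continuous u₀ ∧ (∀ z, u₀ z ≠ 0) ∧ (fun z => u₀ z ^ n) = w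
      · obtain ⟨u₀, hc₀, hn₀, rfl⟩ := hne
        have hfin : {ω : ℂ | ω ^ n = 1}.Finite := by
          refine (Polynomial.nthRoots n (1 : ℂ)).toFinset.finite_toSet.subset fun ω hω => ?_
          simpa [Polynomial.mem_nthRoots hn] using hω
        refine (hfin.image fun ω z => ω * u₀ z).subset ?_
        rintro u ⟨hc, _, hu⟩
        have hmaps : Set.MapsTo (fun z => u z / u₀ z) Set.univ {ω : ℂ | ω ^ n = 1} := fun z _ => by
          have : u z ^ n = u₀ z ^ n := congrFun hu z
          simp [div_pow, this, hn₀ z]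
        refine ⟨u I / u₀ I, hmaps (Set.mem_univ _), funext fun z => ?_⟩
        have : u I / u₀ I = u z / u₀ z := isPreconnected_univ.constant_of_mapsTo hfin.isDiscrete
          (hc.div hc₀ hn₀).continuousOn hmaps (Set.mem_univ I) (Set.mem_univ z)
        change u I / u₀ I * u₀ z = u z
        rw [this, div_mul_cancel₀ _ (hn₀ z)]
      · convert Set.finite_empty
        ext u
        simpa using fun h1 h2 h3 => hne ⟨u, h1, h2, h3⟩
    · rintro _ ⟨γ, rfl⟩
      simp only [Set.mem_iUnion]
      refine ⟨_, ⟨γ, rfl⟩, ?_, fun z => h0 _, rfl⟩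
      exact hf.continuous.comp (continuous_const_smul (γ : GL (Fin 2) ℝ))
  growth γ := by
    obtain ⟨C, hC, hO⟩ := h.growth γ
    refine ⟨C, hC, IsBigO.trans (g := fun z : ℍ => 1 + ‖f (γ • z) ^ n‖) ?_
      ((one_isBigO_exp_atImInfty hC).add hO.norm_left)⟩
    refine .of_bound 1 <| .of_forall fun z => ?_
    rw [one_mul, Real.norm_of_nonneg (by positivity), norm_pow]
    rcases le_total ‖f (γ • z)‖ 1 with h1 | h1
    · exact h1.trans (by simp)
    · exact (le_self_pow₀ h1 hn.ne').trans (by simp)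

end IsModularFunction

local notation "Δ" => ModularForm.discriminant

/-- The real matrix attached to an integral matrix of nonzero determinant. -/
noncomputable def FixedDetMatrices.toGL {D : ℤ} (hD : D ≠ 0) (A : FixedDetMatrix (Fin 2) ℤ D) :
    GL (Fin 2) ℝ :=
  Matrix.GeneralLinearGroup.mkOfDetNeZero (A.1.map (Int.castRingHom ℝ)) <| by
    rw [← RingHom.mapMatrix_apply, ← RingHom.map_det, A.2]
    simpa using hD

open FixedDetMatrices

variable {D : ℤ} (hD : D ≠ 0)

lemma toGL_smul (γ : SL(2, ℤ)) (A : FixedDetMatrix (Fin 2) ℤ D) :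
    toGL hD (γ • A) = (γ : GL (Fin 2) ℝ) * toGL hD A := by
  ext i j
  simp [toGL, smul_coe, Matrix.mul_apply, Fin.sum_univ_two]

/-- Right multiplication of an integral matrix by an element of `SL(2, ℤ)`. -/
def FixedDetMatrices.mulRight (A : FixedDetMatrix (Fin 2) ℤ D) (γ : SL(2, ℤ)) :
    FixedDetMatrix (Fin 2) ℤ D :=
  ⟨A.1 * γ.1, by rw [Matrix.det_mul, A.2, γ.2, mul_one]⟩

lemma toGL_mulRight (A : FixedDetMatrix (Fin 2) ℤ D) (γ : SL(2, ℤ)) :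
    toGL hD (mulRight A γ) = toGL hD A * (γ : GL (Fin 2) ℝ) := by
  ext i j
  simp [toGL, mulRight, Matrix.mul_apply, Fin.sum_univ_two]

lemma FixedDetMatrices.exists_smul_mem_reps {D : ℤ} (hD : D ≠ 0) (A : FixedDetMatrix (Fin 2) ℤ D) :
    ∃ γ : SL(2, ℤ), γ • A ∈ reps D := by
  induction A using FixedDetMatrices.induction_on hD with
  | h0 A h1 h2 h3 h4 => exact ⟨1, by rw [one_smul]; exact ⟨h1, h2, h3, h4⟩⟩
  | hS B hB =>
    obtain ⟨γ, hγ⟩ := hB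
    exact ⟨γ * ModularGroup.S⁻¹, by rwa [mul_smul, inv_smul_smul]⟩
  | hT B hB =>
    obtain ⟨γ, hγ⟩ := hB
    exact ⟨γ * ModularGroup.T⁻¹, by rwa [mul_smul, inv_smul_smul]⟩

lemma discriminant_slash (γ : SL(2, ℤ)) : Δ ∣[(12 : ℤ)] γ = Δ :=
  SlashInvariantForm.slash_action_generators_SL2Z discriminant_S_invariant
    discriminant_T_invariant γ

lemma exists_mem_reps_slash (A : FixedDetMatrix (Fin 2) ℤ D) (γ : SL(2, ℤ)) :
    ∃ B ∈ reps D, (Δ ∣[(12 : ℤ)] toGL hD A) ∣[(12 : ℤ)] γ = Δ ∣[(12 : ℤ)] toGL hD B := by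
  obtain ⟨δ, hδ⟩ := exists_smul_mem_reps hD (mulRight A γ)
  refine ⟨_, hδ, ?_⟩
  rw [toGL_smul, SlashAction.slash_mul, ← SL_slash, discriminant_slash, toGL_mulRight,
    SlashAction.slash_mul, SL_slash]

lemma exists_discriminant_slash_growth {g : GL (Fin 2) ℝ} (hg : g 1 0 = 0) :
    ∃ C : ℝ, 0 ≤ C ∧ (Δ ∣[(12 : ℤ)] g) =O[atImInfty] (fun _ => (1 : ℝ)) ∧
      (fun z => ((Δ ∣[(12 : ℤ)] g) z)⁻¹) =O[atImInfty] fun z => Real.exp (C * z.im) := by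
  have hdet : |g.det.val| ^ (12 - 1 : ℤ) ≠ 0 :=
    zpow_ne_zero _ (abs_ne_zero.2 g.det.ne_zero)
  have hdenom (z : ℍ) : denom g z = (g 1 1 : ℂ) := by simp [denom, hg]
  have hg11 : (g 1 1 : ℂ) ≠ 0 := hdenom I ▸ denom_ne_zero g I
  set K : ℝ := |g.det.val| ^ (12 - 1 : ℤ) * ‖(g 1 1 : ℂ) ^ (-12 : ℤ)‖ with hK
  have hK0 : K ≠ 0 := mul_ne_zero hdet (norm_ne_zero_iff.2 (zpow_ne_zero _ hg11))
  have hnorm (z : ℍ) : ‖(Δ ∣[(12 : ℤ)] g) z‖ = ‖Δ (g • z)‖ * K := by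
    rw [slash_apply, hdenom, norm_mul, norm_mul, norm_σ, hK, ← mul_assoc]
    simp
  have htend := tendsto_smul_atImInfty hg
  refine ⟨2 * Real.pi * |g 0 0 / g 1 1|, by positivity, ?_, ?_⟩
  · have h1 : (Δ ∘ fun z : ℍ => g • z) =O[atImInfty] (fun _ => (1 : ℝ)) :=
      (discriminant_isZeroAtImInfty.comp htend).isBigO_one ℝ
    refine IsBigO.trans (.of_bound K (.of_forall fun z => ?_)) h1
    rw [hnorm, mul_comm]; rfl
  · have h1 := (exp_isBigO_discriminant.comp_tendsto htend).inv_rev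
      (.of_forall fun z h => absurd h (Real.exp_pos _).ne')
    refine (IsBigO.trans (.of_bound K⁻¹ (.of_forall fun z => ?_)) h1).congr_right fun z => ?_
    · rw [norm_inv, hnorm, mul_inv, mul_comm, Function.comp_apply, norm_inv]
    · rw [Function.comp_apply, ← Real.exp_neg]
      congr 1
      simp [im_smul, num, hdenom, abs_div, abs_mul, abs_of_pos z.im_pos]
      ring

lemma exists_mem_reps_slash_div (A : FixedDetMatrix (Fin 2) ℤ D) (γ : SL(2, ℤ)) :
    ∃ B ∈ reps D, ∀ z : ℍ, (Δ ∣[(12 : ℤ)] toGL hD A) (γ • z) / Δ (γ • z) =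
      (Δ ∣[(12 : ℤ)] toGL hD B) z / Δ z := by
  obtain ⟨B, hB, h⟩ := exists_mem_reps_slash hD A γ
  refine ⟨B, hB, fun z => ?_⟩
  have h2 := congrFun (discriminant_slash γ) z
  rw [SL_slash_apply] at h2
  rw [← h, SL_slash_apply, ← h2, mul_div_mul_right _ _ (zpow_ne_zero _ (denom_ne_zero _ _))]

lemma discriminant_slash_ne_zero (g : GL (Fin 2) ℝ) (z : ℍ) : (Δ ∣[(12 : ℤ)] g) z ≠ 0 := by
  rw [slash_apply]
  refine mul_ne_zero (mul_ne_zero ?_ ?_) (zpow_ne_zero _ (denom_ne_zero _ _))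
  · simpa using discriminant_ne_zero (g • z)
  · exact zpow_ne_zero _ (by simpa using g.det.ne_zero)

lemma mdifferentiable_discriminant_slash (g : GL (Fin 2) ℝ) : MDiff (Δ ∣[(12 : ℤ)] g) :=
  CuspForm.discriminant.holo'.slash _ _

lemma discriminant_growth : ∃ C : ℝ, 0 ≤ C ∧ Δ =O[atImInfty] (fun _ => (1 : ℝ)) ∧
    (fun z => (Δ z)⁻¹) =O[atImInfty] fun z => Real.exp (C * z.im) := by
  simpa using exists_discriminant_slash_growth (g := 1) (by simp)

lemma toGL_apply_one_zero {B : FixedDetMatrix (Fin 2) ℤ D} (hB : B ∈ reps D) :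
    toGL hD B 1 0 = 0 := by
  simpa [toGL] using hB.1

lemma UpperHalfPlane.mdifferentiable_div {f g : ℍ → ℂ} (hf : MDiff f) (hg : MDiff g)
    (h0 : ∀ z, g z ≠ 0) : MDiff fun z => f z / g z := by
  rw [mdifferentiable_iff] at *
  exact hf.div hg fun z _ => h0 _

lemma isModularFunction_slash_div (A : FixedDetMatrix (Fin 2) ℤ D) :
    IsModularFunction fun z => (Δ ∣[(12 : ℤ)] toGL hD A) z / Δ z where
  mdiff := mdifferentiable_div (mdifferentiable_discriminant_slash _)
    CuspForm.discriminant.holo' discriminant_ne_zero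
  finite := ((reps D).toFinite.image fun B z => (Δ ∣[(12 : ℤ)] toGL hD B) z / Δ z).subset <| by
    rintro _ ⟨γ, rfl⟩
    obtain ⟨B, hB, h⟩ := exists_mem_reps_slash_div hD A γ
    exact ⟨B, hB, funext fun z => (h z).symm⟩
  growth γ := by
    obtain ⟨B, hB, h⟩ := exists_mem_reps_slash_div hD A γ
    obtain ⟨_, _, h1, _⟩ := exists_discriminant_slash_growth (toGL_apply_one_zero hD hB)
    obtain ⟨C, hC, _, h2⟩ := discriminant_growth
    refine ⟨C, hC, (h1.mul h2).congr (fun z => ?_) fun z => one_mul _⟩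
    rw [h z, div_eq_mul_inv]

lemma isModularFunction_div_slash (A : FixedDetMatrix (Fin 2) ℤ D) :
    IsModularFunction fun z => Δ z / (Δ ∣[(12 : ℤ)] toGL hD A) z where
  mdiff := mdifferentiable_div CuspForm.discriminant.holo' (mdifferentiable_discriminant_slash _)
    (discriminant_slash_ne_zero _)
  finite := ((reps D).toFinite.image fun B z => Δ z / (Δ ∣[(12 : ℤ)] toGL hD B) z).subset <| by
    rintro _ ⟨γ, rfl⟩
    obtain ⟨B, hB, h⟩ := exists_mem_reps_slash_div hD A γ
    exact ⟨B, hB, funext fun z => by simpa only [inv_div] using congrArg (·⁻¹) (h z).symm⟩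
  growth γ := by
    obtain ⟨B, hB, h⟩ := exists_mem_reps_slash_div hD A γ
    obtain ⟨C, hC, _, h1⟩ := exists_discriminant_slash_growth (toGL_apply_one_zero hD hB)
    obtain ⟨_, _, h2, _⟩ := discriminant_growth
    refine ⟨C, hC, (h2.mul h1).congr (fun z => ?_) fun z => one_mul _⟩
    rw [← div_eq_mul_inv, ← inv_div _ (Δ z), ← h z, inv_div]

end ModularFunctions

section EtaQuotients

open UpperHalfPlane ModularForm Filter Topology MatrixGroups Manifold Asymptotics
open FixedDetMatrices

local notation "Δ" => ModularForm.discriminant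
local notation "𝕢" => Function.Periodic.qParam

/-- The discriminant as a function of the nome. -/
noncomputable def discriminantNome (q : ℂ) : ℂ := q * eulerProd q ^ 24

lemma norm_nome_lt_one (z : ℍ) : ‖𝕢 1 z‖ < 1 :=
  Function.Periodic.norm_qParam_lt_one one_pos z.im_pos

lemma mdifferentiable_comp_nome {u : ℂ → ℂ} (hu : DifferentiableOn ℂ u (Metric.ball 0 1)) {c : ℂ}
    (hc : ‖c‖ = 1) : MDiff fun z : ℍ => u (c * 𝕢 1 z) := by
  rw [mdifferentiable_iff]
  refine DifferentiableOn.congr (f := fun z => u (c * 𝕢 1 z)) (hu.comp (t := _) ?_ fun z hz => ?_)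
    fun z hz => ?_
  · exact ((Function.Periodic.differentiable_qParam).const_mul c).differentiableOn
  · simpa [hc] using Function.Periodic.norm_qParam_lt_one one_pos hz
  · simp [ofComplex_apply_of_im_pos hz]

lemma discriminant_eq_discriminantNome (z : ℍ) : Δ z = discriminantNome (𝕢 1 z) := by
  rw [discriminant_eq_q_prod, discriminantNome, eulerProd]
  congr 1
  rw [← Multipliable.tprod_pow]
  simpa [Function.Periodic.qParam] using multipliable_one_sub_pow (norm_nome_lt_one z)

lemma discriminant_slash_upper {a b d : ℤ} (ha : 0 < a) (hd : 0 < d) :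
    ∃ K : ℂ, K ≠ 0 ∧ ∀ z : ℍ, (Δ ∣[(12 : ℤ)] toGL (mul_pos ha hd).ne'
      ⟨!![a, b; 0, d], by simp [Matrix.det_fin_two]⟩) z =
        discriminantNome (𝕢 1 ((a * z + b) / d)) * K := by
  set g := toGL (mul_pos ha hd).ne' ⟨!![a, b; 0, d], by simp [Matrix.det_fin_two]⟩ with hg
  have h00 : g 0 0 = a := by simp [hg, toGL]
  have h01 : g 0 1 = b := by simp [hg, toGL]
  have h10 : g 1 0 = 0 := by simp [hg, toGL]
  have h11 : g 1 1 = d := by simp [hg, toGL]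
  have hdet : g.det.val = a * d := by
    simp [Matrix.det_fin_two, h00, h01, h10, h11]
  have hpos : 0 < g.det.val := by
    rw [hdet]; exact_mod_cast mul_pos ha hd
  have hdenom (z : ℍ) : denom g z = d := by simp [denom, h10, h11]
  refine ⟨|g.det.val| ^ (12 - 1 : ℤ) * (d : ℂ) ^ (-12 : ℤ), ?_, fun z => ?_⟩
  · have : (d : ℂ) ≠ 0 := by exact_mod_cast hd.ne'
    have h2 : ((|g.det.val| : ℝ) : ℂ) ≠ 0 := by
      exact_mod_cast abs_ne_zero.2 hpos.ne'
    exact mul_ne_zero (zpow_ne_zero _ h2) (zpow_ne_zero _ this)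
  · rw [slash_apply, hdenom, discriminant_eq_discriminantNome, coe_smul_of_det_pos hpos, hdenom]
    have hσ : σ g = .refl ℝ ℂ := if_pos hpos
    rw [hσ]
    simp only [num, h00, h01, Complex.ofReal_intCast, ContinuousAlgEquiv.refl_apply, mul_assoc]

lemma isModularFunction_discriminantNome_div {a b d : ℤ} (ha : 0 < a) (hd : 0 < d) :
    IsModularFunction fun z : ℍ => discriminantNome (𝕢 1 ((a * z + b) / d)) /
      discriminantNome (𝕢 1 z) := by
  obtain ⟨K, hK, h⟩ := discriminant_slash_upper (b := b) ha hd
  convert (isModularFunction_slash_div (mul_pos ha hd).ne'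
      ⟨!![a, b; 0, d], by simp [Matrix.det_fin_two]⟩).mul (.const K⁻¹) using 2 with z
  rw [h, discriminant_eq_discriminantNome]
  field_simp

lemma isModularFunction_div_discriminantNome {a b d : ℤ} (ha : 0 < a) (hd : 0 < d) :
    IsModularFunction fun z : ℍ => discriminantNome (𝕢 1 z) /
      discriminantNome (𝕢 1 ((a * z + b) / d)) := by
  obtain ⟨K, hK, h⟩ := discriminant_slash_upper (b := b) ha hd
  convert (isModularFunction_div_slash (mul_pos ha hd).ne'
      ⟨!![a, b; 0, d], by simp [Matrix.det_fin_two]⟩).mul (.const K) using 2 with z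
  rw [h, discriminant_eq_discriminantNome]
  field_simp

lemma isModularFunction_discriminantNome_pow {l : ℕ} (hl : 0 < l) :
    IsModularFunction fun z : ℍ => discriminantNome (𝕢 1 z ^ l) / discriminantNome (𝕢 1 z) := by
  convert isModularFunction_discriminantNome_div (a := l) (b := 0) (d := 1) (by exact_mod_cast hl)
    one_pos using 4 with z
  simp only [Function.Periodic.qParam, ← Complex.exp_nat_mul]
  push_cast
  ring_nf

lemma isModularFunction_eulerProd_div {m : ℕ} (hm : 0 < m) (j : ℕ) :
    IsModularFunction fun z : ℍ => eulerProd (𝕢 1 z) /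
      eulerProd (Complex.exp (2 * Real.pi * Complex.I / m) ^ j * 𝕢 1 z) := by
  have hm' : (m : ℂ) ≠ 0 := by exact_mod_cast hm.ne'
  set ζ := Complex.exp (2 * Real.pi * Complex.I / m) with hζ
  have hζ0 : ζ ≠ 0 := Complex.exp_ne_zero _
  have hζ1 : ‖ζ ^ j‖ = 1 := by
    rw [norm_pow, (Complex.isPrimitiveRoot_exp m hm.ne').norm'_eq_one hm.ne', one_pow]
  have hlt (z : ℍ) : ‖ζ ^ j * 𝕢 1 z‖ < 1 := by
    rw [norm_mul, hζ1, one_mul]; exact norm_nome_lt_one z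
  have hn1 (z : ℍ) := eulerProd_ne_zero (norm_nome_lt_one z)
  have hn2 (z : ℍ) := eulerProd_ne_zero (hlt z)
  refine .of_pow (n := 24) (by norm_num) (mdifferentiable_div ?_ ?_ hn2)
    (fun z => div_ne_zero (hn1 z) (hn2 z)) ?_
  · simpa using mdifferentiable_comp_nome differentiableOn_eulerProd (norm_one (α := ℂ))
  · exact mdifferentiable_comp_nome differentiableOn_eulerProd hζ1
  · convert (isModularFunction_div_discriminantNome (a := m) (b := j) (d := m)
      (by exact_mod_cast hm) (by exact_mod_cast hm)).mul (.const (ζ ^ j)) using 2 with z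
    have hq : 𝕢 1 ((((m : ℤ) : ℂ) * z + ((j : ℤ) : ℂ)) / ((m : ℤ) : ℂ)) = ζ ^ j * 𝕢 1 z := by
      simp only [hζ, Function.Periodic.qParam, ← Complex.exp_nat_mul, ← Complex.exp_add]
      congr 1
      push_cast
      field_simp
      ring
    have hz := Function.Periodic.qParam_ne_zero (h := 1) (z : ℂ)
    have := hn2 z
    rw [hq, discriminantNome, discriminantNome, div_pow]
    field_simp

end EtaQuotients

section AlgebraicRelations

open UpperHalfPlane ModularForm Filter Topology MatrixGroups Manifold Asymptotics PowerSeries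

local notation "𝕢" => Function.Periodic.qParam

lemma eq_zero_of_invariant_of_isZeroAtImInfty {f : ℍ → ℂ} (hf : MDiff f)
    (hinv : ∀ (γ : SL(2, ℤ)) (z : ℍ), f (γ • z) = f z) (h0 : IsZeroAtImInfty f) : f = 0 := by
  have hslash (γ : SL(2, ℤ)) : f ∣[(0 : ℤ)] γ = f := by
    ext z
    rw [SL_slash_apply, hinv, neg_zero, zpow_zero, mul_one]
  let F : ModularForm 𝒮ℒ 0 :=
    { toFun := f
      slash_action_eq' := by
        rintro _ ⟨γ, rfl⟩
        exact hslash γ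
      holo' := hf
      bdd_at_cusps' := fun hc => by
        rw [Subgroup.IsArithmetic.isCusp_iff_isCusp_SL2Z] at hc
        rw [OnePoint.isBoundedAt_iff_forall_SL2Z hc]
        intro γ _
        rw [hslash]
        exact h0.isBoundedAtImInfty }
  obtain ⟨c, hc⟩ := ModularFormClass.levelOne_weight_zero_const F
  have hfc : f = Function.const _ c := hc
  have : c = 0 := tendsto_nhds_unique (f := f) (l := atImInfty)
    (hfc ▸ tendsto_const_nhds) h0
  rw [hfc, this]; rfl

lemma HasExpansion.isBigO_atImInfty {A : PowerSeries ℂ} {u : ℂ → ℂ} (hA : HasExpansion A u)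
    {D : ℕ} (h : ∀ n < D, coeff n A = 0) :
    (fun z : ℍ => u (𝕢 1 z)) =O[atImInfty] fun z => Real.exp (-D * z.im) := by
  have h1 := (hA.isBigO h).comp_tendsto
    (qParam_tendsto_atImInfty one_pos)
  refine h1.trans (.of_bound 1 (.of_forall fun z => ?_))
  simp only [Function.comp_apply, Function.Periodic.norm_qParam, ← Real.exp_nat_mul, one_mul,
    Real.norm_eq_abs, Real.abs_exp, Real.exp_le_exp, coe_im]
  have := mul_nonneg D.cast_nonneg (α := ℝ) z.im_pos.le
  nlinarith [Real.pi_gt_three]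

lemma HasExpansion.eq_zero_of_comp_nome {A : PowerSeries ℂ} {u : ℂ → ℂ} (hA : HasExpansion A u)
    (h : ∀ z : ℍ, u (𝕢 1 z) = 0) : A = 0 := by
  have hz (q : ℂ) (hq : ‖q‖ < 1) (hq0 : q ≠ 0) : u q = 0 := by
    rw [← Function.Periodic.qParam_right_inv (h := 1) one_ne_zero hq0]
    have him : 0 < (Function.Periodic.invQParam 1 q).im := by
      rw [← Function.Periodic.qParam_right_inv (h := 1) one_ne_zero hq0] at hq
      simpa using (Function.Periodic.norm_qParam_lt_iff one_pos 0 _).1 (by simpa using hq)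
    exact h ⟨_, him⟩
  have hX : X ^ 1 * A = 0 := ((HasExpansion.X_pow 1).mul hA).unique <|
    (map_zero (C (R := ℂ)) ▸ HasExpansion.const 0).congr fun q hq => by
      rcases eq_or_ne q 0 with rfl | hq0
      · simp
      · rw [hz q hq hq0, mul_zero]
  exact (mul_eq_zero.1 hX).resolve_left (pow_ne_zero _ X_ne_zero)

lemma MDifferentiable.comp_smul {f : ℍ → ℂ} (hf : MDiff f) (γ : SL(2, ℤ)) :
    MDiff fun z : ℍ => f (γ • z) := by
  have h : (fun z : ℍ => f (γ • z)) = f ∣[(0 : ℤ)] γ := funext fun z => by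
    rw [SL_slash_apply, neg_zero, zpow_zero, mul_one]
  rw [h]
  exact hf.slash 0 _

/-- A sum of monomials in two modular functions which vanishes to high order at `i∞` is zero. -/
lemma IsModularFunction.exists_forall_eq_zero {f g : ℍ → ℂ} (hf : IsModularFunction f)
    (hg : IsModularFunction g) : ∃ C : ℕ, ∀ (N : ℕ) (c : Fin N × Fin N → ℂ),
      (fun z => ∑ i, c i * (f z ^ (i.1 : ℕ) * g z ^ (i.2 : ℕ))) =O[atImInfty]
        (fun z => Real.exp (-(N * C + 1 : ℕ) * z.im)) →
      ∀ z, ∑ i, c i * (f z ^ (i.1 : ℕ) * g z ^ (i.2 : ℕ)) = 0 := by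
  set S : Set ((ℍ → ℂ) × (ℍ → ℂ)) :=
    Set.range fun γ : SL(2, ℤ) => (fun z => f (γ • z), fun z => g (γ • z)) with hS
  have hfin : S.Finite := (hf.finite.prod hg.finite).subset <| by
    rintro _ ⟨γ, rfl⟩
    exact ⟨⟨γ, rfl⟩, ⟨γ, rfl⟩⟩
  have hfgS : (f, g) ∈ hfin.toFinset := by
    rw [hfin.mem_toFinset]
    exact ⟨1, by simp only [one_smul]⟩
  have hgrowth : ∃ B : ℝ, 0 ≤ B ∧ ∀ w ∈ hfin.toFinset,
      w.1 =O[atImInfty] (fun z => Real.exp (B * z.im)) ∧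
      w.2 =O[atImInfty] (fun z => Real.exp (B * z.im)) := by
    have h1 : ∀ w ∈ hfin.toFinset, ∃ B : ℝ, 0 ≤ B ∧
        w.1 =O[atImInfty] (fun z => Real.exp (B * z.im)) ∧
        w.2 =O[atImInfty] (fun z => Real.exp (B * z.im)) := by
      simp only [hfin.mem_toFinset]
      rintro _ ⟨γ, rfl⟩
      obtain ⟨a, ha, h1⟩ := hf.growth γ
      obtain ⟨b, hb, h2⟩ := hg.growth γ
      exact ⟨max a b, ha.trans (le_max_left _ _),
        h1.trans (exp_isBigO_exp_atImInfty (le_max_left _ _)),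
        h2.trans (exp_isBigO_exp_atImInfty (le_max_right _ _))⟩
    choose! b hb h1 using h1
    refine ⟨∑ w ∈ hfin.toFinset, b w, Finset.sum_nonneg hb, fun w hw => ?_⟩
    have hle := Finset.single_le_sum hb hw
    exact ⟨(h1 w hw).1.trans (exp_isBigO_exp_atImInfty hle),
      (h1 w hw).2.trans (exp_isBigO_exp_atImInfty hle)⟩
  obtain ⟨B, hB0, hB⟩ := hgrowth
  set K := hfin.toFinset.card with hK
  refine ⟨⌈2 * B * K⌉₊, fun N c hO => ?_⟩
  let H : ((ℍ → ℂ) × (ℍ → ℂ)) → ℍ → ℂ := fun w z =>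
    ∑ i, c i * (w.1 z ^ (i.1 : ℕ) * w.2 z ^ (i.2 : ℕ))
  have hHO (w) (hw : w ∈ hfin.toFinset) :
      H w =O[atImInfty] fun z => Real.exp (2 * N * B * z.im) := by
    refine IsBigO.fun_sum fun i _ => IsBigO.const_mul_left ?_ (c i)
    refine (((hB w hw).1.pow i.1).mul ((hB w hw).2.pow i.2)).trans
      (.of_bound 1 (.of_forall fun z => ?_))
    simp only [← Real.exp_nat_mul, ← Real.exp_add, one_mul, Real.norm_eq_abs, Real.abs_exp,
      Real.exp_le_exp]
    have h1 : ((i.1 : ℕ) : ℝ) ≤ N := by exact_mod_cast i.1.2.le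
    have h2 : ((i.2 : ℕ) : ℝ) ≤ N := by exact_mod_cast i.2.2.le
    have h3 := mul_nonneg hB0 z.im_pos.le
    nlinarith
  have hprodO : (∏ w ∈ hfin.toFinset, H w) =O[atImInfty] fun z => Real.exp (-1 * z.im) := by
    rw [← Finset.mul_prod_erase _ _ hfgS]
    have h1 := IsBigO.finsetProd (s := hfin.toFinset.erase (f, g)) (l := atImInfty) (f := H)
      (g := fun _ z => Real.exp (2 * N * B * z.im)) fun w hw => hHO w (Finset.mem_of_mem_erase hw)
    refine ((hO.mul h1).congr_left (f₂ := H (f, g) * ∏ w ∈ hfin.toFinset.erase (f, g), H w)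
      fun z => by simp [H]).trans (.of_bound 1 (.of_forall fun z => ?_))
    simp only [Finset.prod_const, Finset.card_erase_of_mem hfgS, ← Real.exp_nat_mul,
      ← Real.exp_add, one_mul, Real.norm_eq_abs, Real.abs_exp, Real.exp_le_exp]
    have hK1 : ((hfin.toFinset.card - 1 : ℕ) : ℝ) ≤ K := by exact_mod_cast Nat.sub_le _ _
    have h2 : (N : ℝ) * (2 * B * K) ≤ N * ⌈2 * B * K⌉₊ :=
      mul_le_mul_of_nonneg_left (Nat.le_ceil _) N.cast_nonneg
    have h3 : ((hfin.toFinset.card - 1 : ℕ) : ℝ) * (2 * N * B) ≤ K * (2 * N * B) :=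
      mul_le_mul_of_nonneg_right hK1 (by positivity)
    push_cast
    nlinarith [z.im_pos]
  have hinv (γ : SL(2, ℤ)) (z : ℍ) :
      (∏ w ∈ hfin.toFinset, H w) (γ • z) = (∏ w ∈ hfin.toFinset, H w) z := by
    simp only [Finset.prod_apply]
    refine Finset.prod_bij (fun w _ => (fun z => w.1 (γ • z), fun z => w.2 (γ • z))) ?_ ?_ ?_ ?_
    · simp only [hfin.mem_toFinset]
      rintro _ ⟨δ, rfl⟩
      exact ⟨δ * γ, by simp only [mul_smul]⟩
    · rintro ⟨w₁, w₂⟩ _ ⟨v₁, v₂⟩ _ h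
      simp only [Prod.mk.injEq] at h ⊢
      exact ⟨funext fun z => by simpa using congrFun h.1 (γ⁻¹ • z),
        funext fun z => by simpa using congrFun h.2 (γ⁻¹ • z)⟩
    · simp only [hfin.mem_toFinset]
      rintro _ ⟨δ, rfl⟩
      exact ⟨_, ⟨δ * γ⁻¹, rfl⟩, by simp [mul_smul]⟩
    · intro w _
      rfl
  have hMD (w) (hw : w ∈ hfin.toFinset) : MDiff (H w) := by
    obtain ⟨γ, rfl⟩ := hfin.mem_toFinset.1 hw
    have h1 := hf.mdiff.comp_smul γ
    have h2 := hg.mdiff.comp_smul γ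
    rw [UpperHalfPlane.mdifferentiable_iff] at h1 h2 ⊢
    exact DifferentiableOn.fun_sum fun i _ => ((h1.pow i.1).mul (h2.pow i.2)).const_mul (c i)
  have hzero : ∏ w ∈ hfin.toFinset, H w = 0 := by
    refine eq_zero_of_invariant_of_isZeroAtImInfty
      (MDifferentiable.prod hMD) hinv (hprodO.trans_tendsto ?_)
    simpa using! tendsto_comap (f := UpperHalfPlane.im)
  obtain ⟨w, hw, hw0⟩ := (prod_eq_zero_iff hMD).1 hzero
  obtain ⟨γ, rfl⟩ := hfin.mem_toFinset.1 hw
  intro z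
  simpa [H] using congrFun hw0 (γ⁻¹ • z)

end AlgebraicRelations

section IntegralRelations

open UpperHalfPlane PowerSeries

local notation "𝕢" => Function.Periodic.qParam

/-- Two integral `q`-series which are modular functions satisfy an algebraic relation over `ℤ`,
which can be chosen to be nontrivial modulo a given integer `p`. -/
lemma exists_int_relation {A B : PowerSeries ℤ} {u v : ℂ → ℂ}
    (hA : HasExpansion (A.map (Int.castRingHom ℂ)) u)
    (hB : HasExpansion (B.map (Int.castRingHom ℂ)) v)
    (hu : IsModularFunction fun z => u (𝕢 1 z)) (hv : IsModularFunction fun z => v (𝕢 1 z))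
    {p : ℤ} (hp : ¬ IsUnit p) :
    ∃ (N : ℕ) (c : Fin N × Fin N → ℤ), (∃ i, ¬ p ∣ c i) ∧
      ∑ i, C (c i) * (A ^ (i.1 : ℕ) * B ^ (i.2 : ℕ)) = 0 := by
  obtain ⟨K, hK⟩ := hu.exists_forall_eq_zero hv
  set N := K + 2 with hN
  let M : Matrix (Fin (N * K + 1)) (Fin N × Fin N) ℤ :=
    .of fun n i => coeff n (A ^ (i.1 : ℕ) * B ^ (i.2 : ℕ))
  obtain ⟨t, ht0, hMt, -⟩ := Int.Matrix.exists_ne_zero_int_vec_norm_le M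
    (by simp only [Fintype.card_prod, Fintype.card_fin]; nlinarith) (by simp)
  have ht1 : ∃ i, t i ≠ 0 := by
    by_contra! h
    exact ht0 (funext h)
  obtain ⟨i₀, hi₀⟩ := ht1
  obtain ⟨c, hc, hgcd⟩ := Finset.extract_gcd t ⟨i₀, Finset.mem_univ _⟩
  have hg0 : Finset.univ.gcd t ≠ 0 := fun h => hi₀ (Finset.gcd_eq_zero_iff.1 h _ (Finset.mem_univ _))
  refine ⟨N, c, ?_, ?_⟩
  · by_contra! h
    exact hp (isUnit_of_dvd_one (hgcd ▸ Finset.dvd_gcd fun i _ => h i))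
  set F := ∑ i, C (c i) * (A ^ (i.1 : ℕ) * B ^ (i.2 : ℕ)) with hF
  have hFexp : HasExpansion (F.map (Int.castRingHom ℂ)) fun q =>
      ∑ i : Fin N × Fin N, (c i : ℂ) * (u q ^ (i.1 : ℕ) * v q ^ (i.2 : ℕ)) := by
    rw [hF, map_sum]
    refine .sum _ fun i _ => ?_
    simpa using ((hA.pow i.1).mul (hB.pow i.2)).C_mul (c i)
  have hcoeff : ∀ n < N * K + 1, coeff n F = 0 := by
    intro n hn
    have h1 := congrFun hMt ⟨n, hn⟩
    simp only [Matrix.mulVec, dotProduct, M, Matrix.of_apply, Pi.zero_apply] at h1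
    refine mul_left_cancel₀ hg0 ?_
    rw [mul_zero, ← h1, hF, map_sum, Finset.mul_sum]
    refine Finset.sum_congr rfl fun i hi => ?_
    rw [coeff_C_mul, hc i hi]
    ring
  have hzero := hFexp.eq_zero_of_comp_nome <| hK N (fun i => c i) <| by
    simpa using hFexp.isBigO_atImInfty (D := N * K + 1) fun n hn => by simp [hcoeff n hn]
  exact PowerSeries.map_injective _ Int.cast_injective (hzero.trans (map_zero _).symm)

end IntegralRelations

section ArithmeticProgressions

open UpperHalfPlane PowerSeries

local notation "𝕢" => Function.Periodic.qParam

/-- The part of the generating function of partitions supported on one residue class. -/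
noncomputable def partitionSeriesModEq (m c : ℕ) : PowerSeries ℤ :=
  PowerSeries.mk fun n => if n ≡ c [MOD m] then (Fintype.card (Nat.Partition n) : ℤ) else 0

lemma IsPrimitiveRoot.pow_eq_pow_iff_natModEq {m : ℕ} {ζ : ℂ} (hζ : IsPrimitiveRoot ζ m)
    (hm : 0 < m) {n c : ℕ} : ζ ^ n = ζ ^ c ↔ n ≡ c [MOD m] := by
  have hζ0 := hζ.ne_zero hm.ne'
  rw [Nat.ModEq.comm, Nat.modEq_iff_dvd, ← hζ.zpow_eq_one_iff_dvd, zpow_sub₀ hζ0,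
    div_eq_one_iff_eq (by simp [hζ0]), zpow_natCast, zpow_natCast]

lemma sum_pow_mul_inv_pow {m : ℕ} {ζ : ℂ} (hζ : IsPrimitiveRoot ζ m) (hm : 0 < m) (n c : ℕ) :
    ∑ j ∈ Finset.range m, (ζ ^ c)⁻¹ ^ j * (ζ ^ j) ^ n = if n ≡ c [MOD m] then (m : ℂ) else 0 := by
  have hζ0 := hζ.ne_zero hm.ne'
  have hterm (j : ℕ) : (ζ ^ c)⁻¹ ^ j * (ζ ^ j) ^ n = (ζ ^ n * (ζ ^ c)⁻¹) ^ j := by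
    rw [mul_pow, ← pow_mul, ← pow_mul, mul_comm j n, mul_comm]
  simp only [hterm]
  split_ifs with h
  · have : ζ ^ n = ζ ^ c := (hζ.pow_eq_pow_iff_natModEq hm).2 h
    simp [this, hζ0]
  · have hne : ζ ^ n * (ζ ^ c)⁻¹ - 1 ≠ 0 := by
      rw [sub_ne_zero, Ne, mul_inv_eq_one₀ (pow_ne_zero _ hζ0), hζ.pow_eq_pow_iff_natModEq hm]
      exact h
    refine mul_left_cancel₀ hne ?_
    rw [mul_geom_sum, mul_zero, mul_pow, inv_pow, ← pow_mul, ← pow_mul, mul_comm n, mul_comm c,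
      pow_mul, pow_mul, hζ.pow_eq_one]
    simp

lemma hasExpansion_partitionSeriesModEq {m : ℕ} (hm : 0 < m) (c : ℕ) :
    HasExpansion ((partitionSeriesModEq m c).map (Int.castRingHom ℂ)) fun q =>
      (m : ℂ)⁻¹ * ∑ j ∈ Finset.range m,
        (Complex.exp (2 * Real.pi * Complex.I / m) ^ c)⁻¹ ^ j *
          (eulerProd (Complex.exp (2 * Real.pi * Complex.I / m) ^ j * q))⁻¹ := by
  set ζ := Complex.exp (2 * Real.pi * Complex.I / m) with hζ
  have hprim : IsPrimitiveRoot ζ m := Complex.isPrimitiveRoot_exp m hm.ne'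
  have hnorm (j : ℕ) : ‖ζ ^ j‖ = 1 := by
    rw [norm_pow, hprim.norm'_eq_one hm.ne', one_pow]
  have h := HasExpansion.C_mul (.sum (Finset.range m) fun j _ =>
    (hasExpansion_inv_eulerProd.rescale (hnorm j)).C_mul ((ζ ^ c)⁻¹ ^ j)) (m : ℂ)⁻¹
  convert h using 1
  ext n
  have hm' : (m : ℂ) ≠ 0 := by exact_mod_cast hm.ne'
  have := sum_pow_mul_inv_pow hprim hm n c
  simp only [partitionSeriesModEq, partitionSeries, coeff_map, coeff_mk, coeff_C_mul, map_sum,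
    coeff_rescale, ← mul_assoc, ← Finset.sum_mul, this]
  split_ifs <;> simp [hm']

lemma exists_int_relation_partitionSeriesModEq {m : ℕ} (hm : 0 < m) (c : ℕ) {l : ℕ}
    (hl : l.Prime) {a : ℤ} (ha : a ≠ 0) {S : PowerSeries ℤ}
    (hS : partitionSeriesModEq m c = C a * S) :
    ∃ (N : ℕ) (c : Fin N × Fin N → ℤ), (∃ i, ¬ (l : ℤ) ∣ c i) ∧
      ∑ i, C (c i) * ((pentagonalSeries ℤ * S) ^ (i.1 : ℕ) *
        (X ^ (l - 1) * expand l hl.ne_zero (pentagonalSeries ℤ) ^ 24 * partitionSeries ℤ ^ 24) ^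
          (i.2 : ℕ)) = 0 := by
  have ha' : (a : ℂ) ≠ 0 := by exact_mod_cast ha
  have hSmap : S.map (Int.castRingHom ℂ) =
      C (a : ℂ)⁻¹ * (partitionSeriesModEq m c).map (Int.castRingHom ℂ) := by
    rw [hS, map_mul, map_C, ← mul_assoc, ← map_mul]
    simp [ha']
  have hpart : (partitionSeries ℤ).map (Int.castRingHom ℂ) = partitionSeries ℂ := by
    ext n
    simp [partitionSeries]
  refine exists_int_relation
    (u := fun q => eulerProd q * ((a : ℂ)⁻¹ * ((m : ℂ)⁻¹ * ∑ j ∈ Finset.range m,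
        (Complex.exp (2 * Real.pi * Complex.I / m) ^ c)⁻¹ ^ j *
          (eulerProd (Complex.exp (2 * Real.pi * Complex.I / m) ^ j * q))⁻¹)))
    (v := fun q => q ^ (l - 1) * eulerProd (q ^ l) ^ 24 * (eulerProd q)⁻¹ ^ 24) ?_ ?_ ?_ ?_
    (Nat.prime_iff_prime_int.1 hl).not_isUnit
  · rw [map_mul, map_pentagonalSeries, hSmap]
    exact hasExpansion_eulerProd.mul ((hasExpansion_partitionSeriesModEq hm c).C_mul _)
  · have hexp : (expand l hl.ne_zero (pentagonalSeries ℤ)).map (Int.castRingHom ℂ) =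
        expand l hl.ne_zero (pentagonalSeries ℂ) := by
      rw [← map_pentagonalSeries (Int.castRingHom ℂ), map_expand]
    simp only [map_mul, map_pow, map_X, hexp, hpart]
    exact ((HasExpansion.X_pow _).mul ((hasExpansion_eulerProd.expand hl.ne_zero).pow 24)).mul
      (hasExpansion_inv_eulerProd.pow 24)
  · convert (IsModularFunction.const ((a : ℂ)⁻¹ * (m : ℂ)⁻¹)).mul (.sum (Finset.range m) fun j _ =>
      (IsModularFunction.const
        ((Complex.exp (2 * Real.pi * Complex.I / m) ^ c)⁻¹ ^ j)).mul
          (isModularFunction_eulerProd_div hm j)) using 2 with z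
    simp only [Finset.mul_sum]
    refine Finset.sum_congr rfl fun j _ => ?_
    ring
  · convert isModularFunction_discriminantNome_pow hl.pos using 2 with z
    have h0 := Function.Periodic.qParam_ne_zero (h := 1) (z : ℂ)
    have hlp : 𝕢 1 (z : ℂ) ^ l = 𝕢 1 (z : ℂ) ^ (l - 1) * 𝕢 1 (z : ℂ) := by
      rw [← pow_succ, Nat.sub_add_cancel hl.one_le]
    have := eulerProd_ne_zero (norm_nome_lt_one z)
    simp only [discriminantNome]
    field_simp
    rw [hlp]
    ring

end ArithmeticProgressions

section Reduction

open PowerSeries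

/-- The monomials `Q ^ i * (X ^ b) ^ j` of degree `i + 24 b j` in a second variable are linearly
independent. -/
lemma sum_monomial_ne_zero {F : Type*} [Field F] {Q : Polynomial F} (hQ : Q ≠ 0) {b : ℕ}
    (hb : 0 < b) {N : ℕ} {c : Fin N × Fin N → F} (hc : ∃ i, c i ≠ 0) :
    ∑ i, Polynomial.monomial ((i.1 : ℕ) + 24 * b * i.2)
      (Polynomial.C (c i) * Q ^ (i.1 : ℕ) * Polynomial.X ^ (b * i.2)) ≠ 0 := by
  have hne : (Finset.univ.filter fun i => c i ≠ 0).Nonempty := by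
    simpa [Finset.Nonempty] using hc
  obtain ⟨i₀, hi₀, hmax⟩ := Finset.exists_max_image _
    (fun i : Fin N × Fin N => (i.1 : ℕ) * Q.natDegree + b * i.2) hne
  simp only [Finset.mem_filter, Finset.mem_univ, true_and] at hi₀ hmax
  intro h
  have h1 := congrArg (fun R => (R.coeff ((i₀.1 : ℕ) + 24 * b * i₀.2)).coeff
    ((i₀.1 : ℕ) * Q.natDegree + b * i₀.2)) h
  simp only [Polynomial.finsetSum_coeff, Polynomial.coeff_monomial, Polynomial.coeff_zero] at h1
  rw [Finset.sum_eq_single i₀] at h1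
  · rw [if_pos rfl, Polynomial.coeff_mul_X_pow, Polynomial.coeff_C_mul,
      ← Polynomial.natDegree_pow, Polynomial.coeff_natDegree] at h1
    exact mul_ne_zero hi₀ (Polynomial.leadingCoeff_ne_zero.2 (pow_ne_zero _ hQ)) h1
  · intro i _ hi
    split_ifs with he
    · by_cases hci : c i = 0
      · simp [hci]
      refine Polynomial.coeff_eq_zero_of_natDegree_lt ?_
      have hdeg : (Polynomial.C (c i) * Q ^ (i.1 : ℕ) * Polynomial.X ^ (b * i.2)).natDegree =
          (i.1 : ℕ) * Q.natDegree + b * i.2 := by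
        rw [Polynomial.natDegree_mul_X_pow _ (mul_ne_zero (by simpa using hci) (pow_ne_zero _ hQ)),
          Polynomial.natDegree_C_mul hci, Polynomial.natDegree_pow]
      rw [hdeg]
      refine lt_of_le_of_ne (hmax i hci) fun heq => hi ?_
      zify at he heq
      have h2 : (b : ℤ) * (((i.2 : ℕ) : ℤ) - (i₀.2 : ℕ)) * (24 * Q.natDegree - 1) = 0 := by
        linear_combination (Q.natDegree : ℤ) * he - heq
      have h3 : ((i.2 : ℕ) : ℤ) = (i₀.2 : ℕ) := by
        rcases mul_eq_zero.1 h2 with h | h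
        · rcases mul_eq_zero.1 h with h | h
          · omega
          · omega
        · omega
      rw [h3] at he
      exact Prod.ext (Fin.ext (by exact_mod_cast add_right_cancel he)) (Fin.ext (by exact_mod_cast h3))
    · rfl
  · simp

lemma dvd_coeff_of_eventually_dvd {m : ℕ} (hm : 0 < m) (c : ℕ) {l : ℕ} (hl : l.Prime) {a : ℤ}
    (ha : a ≠ 0) {S : PowerSeries ℤ} (hS : partitionSeriesModEq m c = C a * S) {n₀ : ℕ}
    (h : ∀ n, n₀ ≤ n → (l : ℤ) ∣ coeff n S) (n : ℕ) : (l : ℤ) ∣ coeff n S := by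
  have : Fact l.Prime := ⟨hl⟩
  set φ := Int.castRingHom (ZMod l)
  obtain ⟨N, w, ⟨i₀, hi₀⟩, hrel⟩ := exists_int_relation_partitionSeriesModEq hm c hl ha hS
  set E := pentagonalSeries (ZMod l)
  set Q : Polynomial (ZMod l) := PowerSeries.trunc n₀ (S.map φ) with hQdef
  have hQ : S.map φ = Q := by
    ext k
    rw [Polynomial.coeff_coe, coeff_trunc, coeff_map]
    split_ifs with hk
    · rfl
    · exact (ZMod.intCast_zmod_eq_zero_iff_dvd _ _).2 (h k (not_lt.1 hk))
  by_cases hQ0 : Q = 0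
  · rw [← ZMod.intCast_zmod_eq_zero_iff_dvd]
    have := congrArg (coeff n) hQ
    simpa [hQ0, φ] using this
  exfalso
  have hP : E * (partitionSeries ℤ).map φ = 1 := by
    have := congrArg (PowerSeries.map φ) pentagonalSeries_mul_partitionSeries
    rwa [map_mul, map_one, map_pentagonalSeries] at this
  have hexp : (expand l hl.ne_zero (pentagonalSeries ℤ)).map φ = E ^ l := by
    rw [map_expand, map_pentagonalSeries]
    simpa using (zmod_pow_prime_pow l E 1).symm
  have hY : (X ^ (l - 1) * expand l hl.ne_zero (pentagonalSeries ℤ) ^ 24 *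
      partitionSeries ℤ ^ 24).map φ = (X : PowerSeries (ZMod l)) ^ (l - 1) * E ^ (24 * (l - 1)) := by
    have h1 : E ^ (l * 24) = E ^ (24 * (l - 1)) * E ^ 24 := by
      rw [← pow_add]
      congr 1
      have := hl.one_le
      omega
    rw [map_mul, map_mul, map_pow, map_pow, map_pow, hexp, map_X, ← pow_mul, h1, mul_assoc,
      mul_assoc, ← mul_pow, hP, one_pow, mul_one]
  refine transcendental_pentagonalSeries l ⟨_, sum_monomial_ne_zero hQ0 (b := l - 1)
    (Nat.sub_pos_of_lt hl.one_lt) (c := fun i => (w i : ZMod l)) ⟨i₀, ?_⟩, ?_⟩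
  · rwa [Ne, ZMod.intCast_zmod_eq_zero_iff_dvd]
  · have h1 := congrArg (PowerSeries.map φ) hrel
    rw [map_zero, map_sum] at h1
    rw [← h1, map_sum]
    refine Finset.sum_congr rfl fun i _ => ?_
    rw [Polynomial.aeval_monomial, map_mul, map_mul, map_pow, map_pow,
      map_mul (PowerSeries.map φ), map_mul (PowerSeries.map φ), map_pow (PowerSeries.map φ),
      map_pow (PowerSeries.map φ), hY, map_mul (PowerSeries.map φ), map_pentagonalSeries, hQ, map_C]
    have halg (R : Polynomial (ZMod l)) :
      algebraMap (Polynomial (ZMod l)) (PowerSeries (ZMod l)) R = R := rfl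
    rw [halg, halg, halg, Polynomial.coe_C, Polynomial.coe_X, eq_intCast]
    change _ * E ^ _ = _ * ((E * _) ^ _ * _)
    ring

/-- A congruence for the partition function which holds eventually on an arithmetic progression
holds on the whole progression. -/
theorem dvd_card_partition_of_modEq {m c d : ℕ} (hm : 0 < m)
    (h : ∀ n : ℕ, d ∣ Fintype.card (Nat.Partition (m * n + c))) {u : ℕ} (hu : u ≡ c [MOD m]) :
    d ∣ Fintype.card (Nat.Partition u) := by
  rw [Nat.dvd_iff_prime_pow_dvd_dvd]
  intro l e hl hle
  have hbig (n : ℕ) (hn : n ≡ c [MOD m]) (hcn : c ≤ n) :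
      l ^ e ∣ Fintype.card (Nat.Partition n) := by
    obtain ⟨k, hk⟩ := (Nat.modEq_iff_dvd' hcn).1 hn.symm
    have := hle.trans (h k)
    rwa [← hk, Nat.sub_add_cancel hcn] at this
  clear hle h
  induction e generalizing u with
  | zero => simp
  | succ e ih =>
    have hdvd (n : ℕ) (hn : n ≡ c [MOD m]) : l ^ e ∣ Fintype.card (Nat.Partition n) :=
      ih hn fun k hk hck => (pow_dvd_pow l e.le_succ).trans (hbig k hk hck)
    have hcoeff (n : ℕ) : ((l : ℤ) ^ e) ∣ coeff n (partitionSeriesModEq m c) := by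
      rw [partitionSeriesModEq, coeff_mk]
      split_ifs with hn
      · exact_mod_cast hdvd n hn
      · exact dvd_zero _
    choose s hs using hcoeff
    have hl0 : (l : ℤ) ^ e ≠ 0 := pow_ne_zero _ (by exact_mod_cast hl.ne_zero)
    have hS : partitionSeriesModEq m c = C ((l : ℤ) ^ e) * PowerSeries.mk s := by
      ext n
      rw [hs, coeff_C_mul, coeff_mk]
    have key := dvd_coeff_of_eventually_dvd hm c hl hl0 hS (n₀ := c) (fun n hn => ?_) u
    · have h1 := hs u
      rw [coeff_mk] at key
      rw [partitionSeriesModEq, coeff_mk, if_pos hu] at h1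
      zify
      rw [h1, pow_succ]
      exact mul_dvd_mul_left _ key
    · rw [coeff_mk]
      refine Int.dvd_of_mul_dvd_mul_left hl0 ?_
      rw [← hs, ← pow_succ, partitionSeriesModEq, coeff_mk]
      split_ifs with hmod
      · exact_mod_cast hbig n hmod hn
      · exact dvd_zero _

end Reduction

lemma dvd_of_crt {s : ℕ} {m a r Mbar : Fin s → ℕ} (hm : ∀ i, 0 < m i)
    (hri : ∀ i, r i ≡ a i * ((∏ t, m t) / m i) * Mbar i [MOD (∏ t, m t)])
    {i t : Fin s} (ht : t ≠ i) : m i ∣ r t := by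
  have hdvd : m i ∣ (∏ j, m j) / m t := by
    rw [← Finset.mul_prod_erase _ _ (Finset.mem_univ t), Nat.mul_div_cancel_left _ (hm t)]
    exact Finset.dvd_prod_of_mem _ (by simp [ht.symm])
  rw [((hri t).of_dvd (Finset.dvd_prod_of_mem m (Finset.mem_univ i))).dvd_iff dvd_rfl]
  exact (hdvd.mul_left _).mul_right _

lemma modEq_of_crt {s : ℕ} {m a r Mbar : Fin s → ℕ}
    (hinv : ∀ i, Mbar i * ((∏ t, m t) / m i) ≡ 1 [MOD m i])
    (hri : ∀ i, r i ≡ a i * ((∏ t, m t) / m i) * Mbar i [MOD (∏ t, m t)]) (i : Fin s) :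
    r i ≡ a i [MOD m i] := by
  have h1 := (hri i).of_dvd (Finset.dvd_prod_of_mem m (Finset.mem_univ i))
  have h2 := (hinv i).mul_left (a i)
  rw [mul_one] at h2
  refine h1.trans ?_
  rwa [mul_assoc, mul_comm _ (Mbar i)]

/-- Congruences for p(n) transfer to P(A; n). -/
theorem crt_congruence (k l s : ℕ) (hk : 0 < k) (hl : 0 < l) (hs : 0 < s)
    (m a r Mbar : Fin s → ℕ)
    (hm : ∀ i, 0 < m i) (ha : ∀ i, 0 < a i) (hr : ∀ i, 0 < r i)
    (hMbar : ∀ i, 0 < Mbar i)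
    (hcop : ∀ i j, i ≠ j → Nat.Coprime (m i) (m j))
    (hacop : ∀ i, Nat.Coprime (a i) (m i))
    (hinv : ∀ i, Mbar i * ((∏ t, m t) / m i) ≡ 1 [MOD m i])
    (hri : ∀ i, r i ≡ a i * ((∏ t, m t) / m i) * Mbar i [MOD (∏ t, m t)])
    (i : Fin s) (c d : ℕ) (hc : 0 < c) (hd : 0 < d)
    (hp : ∀ n : ℕ, d ∣ Fintype.card (Nat.Partition (m i * n + c))) :
    ∀ n : ℕ, d ∣ partP {x | ∃ j : Fin s → ℕ, ∃ js : ℕ,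
        (∀ i, j i ≤ m i - 1) ∧ js ≤ l - 1 ∧
        x = (∑ i, r i * j i) + (∏ t, m t) * k * js} (m i * n + a i * c) := by
  intro n
  have hra := modEq_of_crt hinv hri i
  have hMdvd : m i ∣ ∏ t, m t := Finset.dvd_prod_of_mem m (Finset.mem_univ i)
  have hsplit (j : Fin s → ℕ) : ∑ t, r t * j t = r i * j i + ∑ t ∈ Finset.univ.erase i, r t * j t :=
    (Finset.add_sum_erase _ _ (Finset.mem_univ i)).symm
  have hrest (j : Fin s → ℕ) (js : ℕ) :
      m i ∣ ∑ t ∈ Finset.univ.erase i, r t * j t + (∏ t, m t) * k * js :=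
    dvd_add (Finset.dvd_sum fun t ht =>
      (dvd_of_crt hm hri (Finset.ne_of_mem_erase ht)).mul_right _)
      ((hMdvd.mul_right _).mul_right _)
  have hupd (j : Fin s → ℕ) (v : ℕ) : ∑ t, r t * Function.update j i v t =
      r i * v + ∑ t ∈ Finset.univ.erase i, r t * j t := by
    rw [hsplit, Function.update_self]
    congr 1
    exact Finset.sum_congr rfl fun t ht => by
      rw [Function.update_of_ne (Finset.ne_of_mem_erase ht)]
  have hle {j : Fin s → ℕ} (hj : ∀ t, j t ≤ m t - 1) {v : ℕ} (hv : v ≤ m i - 1) (t : Fin s) :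
      Function.update j i v t ≤ m t - 1 := by
    rcases eq_or_ne t i with rfl | h
    · rwa [Function.update_self]
    · rw [Function.update_of_ne h]; exact hj t
  refine dvd_partP _ (r i) (m i) (hr i).ne' ?_ (fun x hx => ?_) (hm i).ne' d _
    fun u hu => dvd_card_partition_of_modEq (hm i) hp ?_
  · exact ⟨0, 0, by simp⟩
  · constructor
    · rintro ⟨j, js, hj, hjs, rfl⟩
      have h0 : j i ≠ 0 := fun h0 => hx <| by
        rw [hsplit, h0, mul_zero, zero_add]; exact hrest j js
      obtain ⟨v, hv⟩ := Nat.exists_eq_succ_of_ne_zero h0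
      have hrv : r i * j i = r i * v + r i := by rw [hv, Nat.mul_succ]
      refine ⟨by rw [hsplit, hrv]; omega, Function.update j i v, js, hle hj ?_, hjs, ?_⟩
      · have := hj i
        omega
      · rw [hupd, hsplit, hrv]
        omega
    · rintro ⟨hrx, j, js, hj, hjs, hxe⟩
      have hxe' : x = r i * (j i + 1) + (∑ t ∈ Finset.univ.erase i, r t * j t +
          (∏ t, m t) * k * js) := by
        rw [hsplit] at hxe
        rw [Nat.mul_succ]
        omega
      have hlt : j i + 1 ≤ m i - 1 := by
        by_contra hcon
        refine hx ?_
        have : j i + 1 = m i := by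
          have := hj i
          have := hm i
          omega
        rw [hxe', this]
        exact dvd_add (dvd_mul_left _ _) (hrest j js)
      refine ⟨Function.update j i (j i + 1), js, hle hj hlt, hjs, ?_⟩
      rw [hupd, hxe', add_assoc]
  · have h1 : a i * u ≡ a i * c [MOD m i] := by
      refine (hra.symm.mul_right u).trans (hu.trans ?_)
      simp [Nat.ModEq]
    exact h1.cancel_left_of_coprime (hacop i).symm
end

section
/- Let the multiset A be generated by (m_1, m_2, m_3) = (2, 3, 5), (a_1, a_2, a_3) = (1,1,1), (r_1, r_2, r_3) = (15, 10, 6), l = 1, so that A is the set of exponents in (1+x^{15})(1+x^{10}+x^{20})(1+x^6+x^{12}+x^{18}+x^{24}), and let B = {n ∈ ℕ : n ≡ 6, 10, 12, 15, 18, 20, 24 (mod 30)}. Then the number of partitions of n with all part multiplicities in A equals the number of partitions of n with all parts in B, and moreover P(A; 5n + 4) ≡ 0 (mod 5) for all n ≥ 0. -/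
open scoped Classical

open PowerSeries Finset
open scoped PowerSeries.WithPiTopology

section EulerProduct

variable (R : Type*) [CommRing R] [TopologicalSpace R]

theorem hasProd_expand_pentagonalSeries (k : ℕ) (hk : k ≠ 0) :
    HasProd (fun i ↦ 1 - (X : R⟦X⟧) ^ (k * (i + 1))) (expand k hk (pentagonalSeries R)) := by
  have h := WithPiTopology.hasProd_one_sub_X_pow R
  have hc : Continuous (expand k hk : R⟦X⟧ →ₐ[R] R⟦X⟧) := by
    rw [continuous_iff_continuousAt]
    intro g
    rw [ContinuousAt, WithPiTopology.tendsto_iff_coeff_tendsto]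
    intro d
    by_cases hd : k ∣ d
    · obtain ⟨m, rfl⟩ := hd
      simp only [coeff_expand_mul]
      exact (WithPiTopology.continuous_coeff R m).tendsto g
    · simp only [coeff_expand_of_not_dvd k hk _ hd]
      exact tendsto_const_nhds
  convert h.map (expand k hk) hc using 2 with i
  simp [pow_mul]

theorem hasProd_ite_dvd_one_sub_X_pow (k : ℕ) (hk : k ≠ 0) :
    HasProd (fun i ↦ if k ∣ i + 1 then 1 - (X : R⟦X⟧) ^ (i + 1) else 1)
      (expand k hk (pentagonalSeries R)) := by
  have hk' : 0 < k := Nat.pos_of_ne_zero hk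
  have hsucc (i : ℕ) : k * (i + 1) - 1 + 1 = k * (i + 1) :=
    Nat.sub_add_cancel (Nat.mul_pos hk' i.succ_pos)
  have hinj : Function.Injective (fun i ↦ k * (i + 1) - 1) := by
    intro a b hab
    have : k * (a + 1) = k * (b + 1) := by rw [← hsucc a, ← hsucc b]; simpa using hab
    simpa [hk] using this
  rw [← hinj.hasProd_iff]
  · convert hasProd_expand_pentagonalSeries R k hk using 2 with i
    simp [hsucc]
  · intro i hi
    rw [if_neg]
    rintro ⟨c, hc⟩
    refine hi ⟨c - 1, ?_⟩
    rcases c with _ | c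
    · simp at hc
    · simp [← hc]

end EulerProduct

/-- The nonzero exponents of `(1 + x ^ 15) (1 + x ^ 10 + x ^ 20) (1 + x ^ 6 + ⋯ + x ^ 24)`. -/
abbrev multiplicitySet : Set ℕ :=
  {6, 10, 12, 15, 16, 18, 20, 21, 22, 24, 25, 26, 27, 28, 31, 32, 33,
    34, 35, 37, 38, 39, 41, 43, 44, 47, 49, 53, 59}

/-- The multiples of exactly one of `15`, `10` and `6`. -/
abbrev partSet : Set ℕ :=
  {b : ℕ | b % 30 = 6 ∨ b % 30 = 10 ∨ b % 30 = 12 ∨ b % 30 = 15 ∨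
    b % 30 = 18 ∨ b % 30 = 20 ∨ b % 30 = 24}

section GeneratingFunctions

variable (R : Type*) [CommRing R]

theorem mk_partP_eq_genFun (A : Set ℕ) [DecidablePred (· ∈ A)] :
    PowerSeries.mk (fun n ↦ (partP A n : R)) =
      Nat.Partition.genFun (fun _ c ↦ if c ∈ A then (1 : R) else 0) := by
  ext n
  simp only [coeff_mk, partP, Nat.Partition.coeff_genFun, card_filter, Finsupp.prod, prod_boole]
  simp

theorem partQ_eq_card_restricted (B : Set ℕ) [DecidablePred (· ∈ B)] (n : ℕ) :
    partQ B n = #(Nat.Partition.restricted n (· ∈ B)) := by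
  simp only [partQ, Nat.Partition.restricted]
  congr

theorem mk_partP_mul_eq :
    PowerSeries.mk (fun n ↦ (partP multiplicitySet n : R)) *
      (expand 15 (by norm_num) (pentagonalSeries R) * expand 10 (by norm_num) (pentagonalSeries R) *
        expand 6 (by norm_num) (pentagonalSeries R)) =
      expand 30 (by norm_num) (pentagonalSeries R) ^ 3 := by
  let _ : TopologicalSpace R := ⊥
  have _ : DiscreteTopology R := ⟨rfl⟩
  have hP := Nat.Partition.hasProd_genFun (fun _ c ↦ if c ∈ multiplicitySet then (1 : R) else 0)
  rw [← mk_partP_eq_genFun] at hP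
  have hL := hP.mul (((hasProd_expand_pentagonalSeries R 15 (by norm_num)).mul
    (hasProd_expand_pentagonalSeries R 10 (by norm_num))).mul
    (hasProd_expand_pentagonalSeries R 6 (by norm_num)))
  have h30 := hasProd_expand_pentagonalSeries R 30 (by norm_num)
  have hR := (h30.mul h30).mul h30
  rw [pow_three']
  refine hL.unique ((congrArg (HasProd · _) (funext fun i ↦ ?_)).mpr hR)
  rw [tsum_eq_sum (s := range 59)]
  · simp only [Finset.sum_range_succ, Finset.sum_range_zero, multiplicitySet,
      Set.mem_insert_iff, Set.mem_singleton_iff]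
    norm_num
    simp only [mul_comm _ (i + 1), pow_mul]
    ring
  · intro j hj
    rw [if_neg, zero_smul]
    simp only [Finset.mem_range, not_lt] at hj
    simp only [Set.mem_insert_iff, Set.mem_singleton_iff]
    omega

theorem mk_partQ_mul_eq :
    PowerSeries.mk (fun n ↦ (partQ partSet n : R)) *
      (expand 15 (by norm_num) (pentagonalSeries R) * expand 10 (by norm_num) (pentagonalSeries R) *
        expand 6 (by norm_num) (pentagonalSeries R)) =
      expand 30 (by norm_num) (pentagonalSeries R) ^ 3 := by
  let _ : TopologicalSpace R := ⊥
  have _ : DiscreteTopology R := ⟨rfl⟩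
  have hQ := Nat.Partition.hasProd_powerSeriesMk_card_restricted R (· ∈ partSet)
  simp_rw [← partQ_eq_card_restricted] at hQ
  have hL := hQ.mul (((hasProd_ite_dvd_one_sub_X_pow R 15 (by norm_num)).mul
    (hasProd_ite_dvd_one_sub_X_pow R 10 (by norm_num))).mul
    (hasProd_ite_dvd_one_sub_X_pow R 6 (by norm_num)))
  have h30 := hasProd_ite_dvd_one_sub_X_pow R 30 (by norm_num)
  have hR := (h30.mul h30).mul h30
  rw [pow_three']
  refine hL.unique ((congrArg (HasProd · _) (funext fun i ↦ ?_)).mpr hR)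
  have hgeom : (∑' j : ℕ, (X : R⟦X⟧) ^ ((i + 1) * j)) * (1 - X ^ (i + 1)) = 1 := by
    simp_rw [pow_mul]
    exact WithPiTopology.tsum_pow_mul_one_sub_of_constantCoeff_eq_zero (by simp)
  by_cases h30 : 30 ∣ i + 1
  · have hB : i + 1 ∉ partSet := by simp only [Set.mem_ofPred_eq]; omega
    have h15 : 15 ∣ i + 1 := by omega
    have h10 : 10 ∣ i + 1 := by omega
    have h6 : 6 ∣ i + 1 := by omega
    rw [if_neg hB, if_pos h15, if_pos h10, if_pos h6, if_pos h30, one_mul]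
  by_cases hB : i + 1 ∈ partSet
  · rw [if_pos hB, if_neg h30]
    simp only [Set.mem_ofPred_eq] at hB
    obtain ⟨h15, h10, h6⟩ | ⟨h15, h10, h6⟩ | ⟨h15, h10, h6⟩ :
        (15 ∣ i + 1 ∧ ¬ 10 ∣ i + 1 ∧ ¬ 6 ∣ i + 1) ∨ (¬ 15 ∣ i + 1 ∧ 10 ∣ i + 1 ∧ ¬ 6 ∣ i + 1) ∨
          (¬ 15 ∣ i + 1 ∧ ¬ 10 ∣ i + 1 ∧ 6 ∣ i + 1) := by omega
    all_goals simp only [h15, h10, h6, if_true, if_false, one_mul, mul_one, hgeom]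
  · rw [if_neg hB, if_neg h30]
    simp only [Set.mem_ofPred_eq] at hB
    rw [if_neg, if_neg, if_neg] <;> first | simp | omega

end GeneratingFunctions

theorem expand_pentagonalSeries_ne_zero (R : Type*) [CommRing R] [Nontrivial R] (k : ℕ)
    (hk : k ≠ 0) : expand k hk (pentagonalSeries R) ≠ 0 := by
  intro h
  have h0 := congrArg (coeff (k * pentagonal 0)) h
  rw [coeff_expand_mul, coeff_pentagonalSeries_pentagonal] at h0
  simp at h0

theorem partP_eq_partQ (n : ℕ) : partP multiplicitySet n = partQ partSet n := by
  have h := (mk_partP_mul_eq ℤ).trans (mk_partQ_mul_eq ℤ).symm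
  have h := mul_right_cancel₀ (mul_ne_zero (mul_ne_zero
    (expand_pentagonalSeries_ne_zero ℤ _ _) (expand_pentagonalSeries_ne_zero ℤ _ _))
    (expand_pentagonalSeries_ne_zero ℤ _ _)) h
  simpa using PowerSeries.ext_iff.mp h n

section Slices

variable {R : Type*} [CommRing R]

/-- The part of a power series supported on the exponents congruent to `r` modulo `m`. -/
noncomputable def residueSlice {m : ℕ} (r : ZMod m) (g : R⟦X⟧) : R⟦X⟧ :=
  PowerSeries.mk fun n ↦ if (n : ZMod m) = r then coeff n g else 0

theorem coeff_residueSlice {m : ℕ} (r : ZMod m) (g : R⟦X⟧) (n : ℕ) :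
    coeff n (residueSlice r g) = if (n : ZMod m) = r then coeff n g else 0 :=
  coeff_mk _ _

theorem residueSlice_mul {m : ℕ} [NeZero m] (r : ZMod m) (g h : R⟦X⟧) :
    residueSlice r (g * h) = ∑ s, residueSlice s g * residueSlice (r - s) h := by
  ext n
  simp only [coeff_residueSlice, map_sum, coeff_mul]
  rw [Finset.sum_comm]
  simp only [ite_mul, zero_mul, Finset.sum_ite_eq, Finset.mem_univ, if_true]
  split_ifs with hn
  · refine Finset.sum_congr rfl fun x hx ↦ ?_
    rw [if_pos]
    rw [← hn, ← Finset.HasAntidiagonal.mem_antidiagonal.mp hx]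
    simp
  · refine (Finset.sum_eq_zero fun x hx ↦ ?_).symm
    rw [if_neg, mul_zero]
    rintro h
    apply hn
    rw [← Finset.HasAntidiagonal.mem_antidiagonal.mp hx, Nat.cast_add, h, add_sub_cancel]

theorem residueSlice_expand_mul {m : ℕ} [NeZero m] (r : ZMod m) (g h : R⟦X⟧) :
    residueSlice r (g * expand m (NeZero.ne m) h) = residueSlice r g * expand m (NeZero.ne m) h := by
  have hz (s : ZMod m) :
      residueSlice s (expand m (NeZero.ne m) h) = if s = 0 then expand m (NeZero.ne m) h else 0 := by
    ext n
    rw [coeff_residueSlice]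
    by_cases hn : m ∣ n
    · have : (n : ZMod m) = 0 := (ZMod.natCast_eq_zero_iff n m).mpr hn
      split_ifs <;> simp_all
    · split_ifs <;> simp [coeff_expand_of_not_dvd m (NeZero.ne m) h hn]
  simp [residueSlice_mul, hz, sub_eq_zero]

end Slices

section PentagonalResidues

variable (R : Type*) [CommRing R]

/-- The part of the pentagonal series supported on the pentagonal numbers whose index is congruent
to `r` modulo `5`. -/
noncomputable def pentagonalPart (r : ZMod 5) : R⟦X⟧ :=
  PowerSeries.mk fun n ↦
    if ∃ k : ℤ, pentagonal k = n ∧ (k : ZMod 5) = r then coeff n (pentagonalSeries R) else 0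

theorem coeff_pentagonalPart_pentagonal (r : ZMod 5) (k : ℤ) :
    coeff (pentagonal k) (pentagonalPart R r) =
      if (k : ZMod 5) = r then (Int.negOnePow k : R) else 0 := by
  simp [pentagonalPart]

theorem coeff_pentagonalPart_eq_zero (r : ZMod 5) {n : ℕ} (h : n ∉ Set.range pentagonal) :
    coeff n (pentagonalPart R r) = 0 := by
  simp [pentagonalPart, coeff_pentagonalSeries_eq_zero R h]

theorem pentagonalSeries_eq_sum_pentagonalPart :
    pentagonalSeries R = ∑ r, pentagonalPart R r := by
  ext n
  rw [map_sum]
  by_cases hn : n ∈ Set.range pentagonal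
  · obtain ⟨k, rfl⟩ := hn
    simp [coeff_pentagonalPart_pentagonal]
  · simp [coeff_pentagonalPart_eq_zero R _ hn, coeff_pentagonalSeries_eq_zero R hn]

theorem natCast_pentagonal_zmod_five (k : ℤ) :
    (pentagonal k : ZMod 5) = 3 * k * (3 * k - 1) := by
  have h : ((2 * (pentagonal k : ℤ) : ℤ) : ZMod 5) = ((k * (3 * k - 1) : ℤ) : ZMod 5) := by
    rw [two_mul_natCast_pentagonal]
  push_cast at h
  have h5 : (5 : ZMod 5) = 0 := rfl
  linear_combination 3 * h - (pentagonal k : ZMod 5) * h5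

theorem residueSlice_pentagonalPart (t r : ZMod 5) :
    residueSlice t (pentagonalPart R r) = if 3 * r * (3 * r - 1) = t then pentagonalPart R r else 0 := by
  ext n
  rw [coeff_residueSlice]
  by_cases hn : n ∈ Set.range pentagonal
  · obtain ⟨k, rfl⟩ := hn
    by_cases hk : (k : ZMod 5) = r
    · rw [natCast_pentagonal_zmod_five, hk]
      split_ifs <;> simp
    · split_ifs <;> simp [coeff_pentagonalPart_pentagonal, hk]
  · split_ifs <;> simp [coeff_pentagonalPart_eq_zero R r hn]

theorem abs_le_pentagonal (k : ℤ) : |k| ≤ pentagonal k := by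
  have h := two_mul_natCast_pentagonal k
  rcases abs_cases k with ⟨hk, h0⟩ | ⟨hk, h0⟩ <;> rw [hk]
  · rcases h0.eq_or_lt with rfl | h1
    · simp
    · nlinarith
  · nlinarith

theorem coeff_pentagonalPart_eq_sum (r : ZMod 5) {n N : ℕ} (h : n ≤ N) :
    coeff n (pentagonalPart R r) = ∑ k ∈ Finset.Icc (-N : ℤ) N,
      if ((k : ℤ) : ZMod 5) = r ∧ pentagonal k = n then (Int.negOnePow k : R) else 0 := by
  by_cases hn : n ∈ Set.range pentagonal
  · obtain ⟨k, rfl⟩ := hn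
    rw [coeff_pentagonalPart_pentagonal, Finset.sum_eq_single k]
    · simp
    · intro l _ hl
      simp [hl]
    · intro hk
      refine absurd ?_ hk
      rw [Finset.mem_Icc, ← abs_le]
      exact (abs_le_pentagonal k).trans (by exact_mod_cast h)
  · rw [coeff_pentagonalPart_eq_zero R r hn]
    refine (Finset.sum_eq_zero fun k _ ↦ if_neg fun hk ↦ hn ⟨k, hk.2⟩).symm

/-- The pairs of indices `(k, l)` with `l ≡ 2 * k - 1` modulo `5` whose pentagonal numbers add up
to `n`. -/
noncomputable def pentagonalPairs (n : ℕ) : Finset (ℤ × ℤ) :=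
  {x ∈ Finset.Icc (-n : ℤ) n ×ˢ Finset.Icc (-n : ℤ) n |
    (x.2 : ZMod 5) = 2 * x.1 - 1 ∧ pentagonal x.1 + pentagonal x.2 = n}

theorem mem_pentagonalPairs {n : ℕ} {k l : ℤ} : (k, l) ∈ pentagonalPairs n ↔
    5 ∣ 2 * k - 1 - l ∧ k * (3 * k - 1) + l * (3 * l - 1) = 2 * n := by
  have hmod : ((l : ℤ) : ZMod 5) = 2 * k - 1 ↔ 5 ∣ 2 * k - 1 - l := by
    have := ZMod.intCast_eq_intCast_iff_dvd_sub l (2 * k - 1) 5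
    push_cast at this
    exact this
  have hsum : pentagonal k + pentagonal l = n ↔
      k * (3 * k - 1) + l * (3 * l - 1) = 2 * n := by
    rw [← two_mul_natCast_pentagonal, ← two_mul_natCast_pentagonal]
    omega
  simp only [pentagonalPairs, Finset.mem_filter, Finset.mem_product, Finset.mem_Icc, hmod, hsum]
  refine and_iff_right_of_imp fun h ↦ ?_
  have hs := hsum.mpr h.2
  have hk := abs_le.mp (abs_le_pentagonal k)
  have hl := abs_le.mp (abs_le_pentagonal l)
  omega

/-- The reflection acting on `(6 * k - 1, 6 * l - 1)` through `(a, b) ↦ (3 a - 4 b, -4 a - 3 b) / 5`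
reverses the signs of the pairs. -/
theorem sum_pentagonalPairs_negOnePow (n : ℕ) :
    ∑ x ∈ pentagonalPairs n, (Int.negOnePow (x.1 + x.2) : R) = 0 := by
  have key {k l : ℤ} (h : (k, l) ∈ pentagonalPairs n) :
      5 * ((3 * k - 4 * l + 1) / 5) = 3 * k - 4 * l + 1 ∧
        5 * ((2 - 4 * k - 3 * l) / 5) = 2 - 4 * k - 3 * l := by
    have := (mem_pentagonalPairs.mp h).1
    omega
  refine Finset.sum_involution
    (fun x _ ↦ ((3 * x.1 - 4 * x.2 + 1) / 5, (2 - 4 * x.1 - 3 * x.2) / 5)) ?_ ?_ ?_ ?_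
  · rintro ⟨k, l⟩ h
    obtain ⟨h1, h2⟩ := key h
    dsimp only
    generalize (3 * k - 4 * l + 1) / 5 = a at *
    generalize (2 - 4 * k - 3 * l) / 5 = b at *
    have hkl : k + l = a + b + (2 * (1 - 3 * a - 3 * b - 3 * l) + 1) := by omega
    have hodd : Odd (2 * (1 - 3 * a - 3 * b - 3 * l) + 1) := odd_two_mul_add_one _
    rw [hkl, Int.negOnePow_add, Int.negOnePow_odd _ hodd]
    simp
  · rintro ⟨k, l⟩ h _ hfix
    obtain ⟨h1, h2⟩ := key h
    simp only [Prod.mk.injEq] at hfix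
    omega
  · rintro ⟨k, l⟩ h
    obtain ⟨h1, h2⟩ := key h
    dsimp only
    obtain ⟨hd, hn⟩ := mem_pentagonalPairs.mp h
    rw [mem_pentagonalPairs]
    generalize (3 * k - 4 * l + 1) / 5 = a at *
    generalize (2 - 4 * k - 3 * l) / 5 = b at *
    refine ⟨by omega, ?_⟩
    have h25 : 25 * (a * (3 * a - 1) + b * (3 * b - 1)) = 25 * (2 * n) := by
      linear_combination (3 * (5 * a + (3 * k - 4 * l + 1)) - 5) * h1 +
        (3 * (5 * b + (2 - 4 * k - 3 * l)) - 5) * h2 + 25 * hn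
    linarith
  · rintro ⟨k, l⟩ h
    obtain ⟨h1, h2⟩ := key h
    simp only [Prod.mk.injEq]
    omega

theorem sum_pentagonalPart_mul_pentagonalPart :
    ∑ r, pentagonalPart R r * pentagonalPart R (2 * r - 1) = 0 := by
  ext n
  rw [map_zero, ← sum_pentagonalPairs_negOnePow R n, map_sum]
  have hcoeff (r : ZMod 5) :
      coeff n (pentagonalPart R r * pentagonalPart R (2 * r - 1)) =
        ∑ k ∈ Finset.Icc (-n : ℤ) n, ∑ l ∈ Finset.Icc (-n : ℤ) n,
          if ((k : ℤ) : ZMod 5) = r then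
            if ((l : ℤ) : ZMod 5) = 2 * r - 1 ∧ pentagonal k + pentagonal l = n then
              (Int.negOnePow (k + l) : R) else 0
          else 0 := by
    have hmul : ∀ x ∈ antidiagonal n,
        coeff x.1 (pentagonalPart R r) * coeff x.2 (pentagonalPart R (2 * r - 1)) =
          ∑ k ∈ Finset.Icc (-n : ℤ) n, ∑ l ∈ Finset.Icc (-n : ℤ) n,
            if (pentagonal k, pentagonal l) = x then
              if ((k : ℤ) : ZMod 5) = r then
                if ((l : ℤ) : ZMod 5) = 2 * r - 1 then (Int.negOnePow (k + l) : R) else 0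
              else 0
            else 0 := by
      intro x hx
      have hx' := Finset.HasAntidiagonal.mem_antidiagonal.mp hx
      rw [coeff_pentagonalPart_eq_sum R r (N := n) (by omega),
        coeff_pentagonalPart_eq_sum R _ (N := n) (by omega), Finset.sum_mul_sum]
      refine Finset.sum_congr rfl fun k _ ↦ Finset.sum_congr rfl fun l _ ↦ ?_
      simp only [Int.negOnePow_add, Prod.ext_iff]
      split_ifs <;> first | (exfalso; tauto) | simp
    rw [coeff_mul, Finset.sum_congr rfl hmul, Finset.sum_comm]
    refine Finset.sum_congr rfl fun k _ ↦ ?_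
    rw [Finset.sum_comm]
    refine Finset.sum_congr rfl fun l _ ↦ ?_
    rw [Finset.sum_ite_eq]
    simp only [Finset.HasAntidiagonal.mem_antidiagonal]
    split_ifs <;> first | rfl | (exfalso; tauto)
  simp only [hcoeff]
  rw [Finset.sum_comm, pentagonalPairs, Finset.sum_filter, Finset.sum_product]
  refine Finset.sum_congr rfl fun k _ ↦ ?_
  rw [Finset.sum_comm]
  simp

end PentagonalResidues

section RamanujanCongruence

theorem residueSlice_four_pentagonalSeries_pow_four :
    residueSlice (4 : ZMod 5) (pentagonalSeries (ZMod 5) ^ 4) = 0 := by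
  have hslice (t : ZMod 5) : residueSlice t (pentagonalSeries (ZMod 5)) =
      ∑ r, if 3 * r * (3 * r - 1) = t then pentagonalPart (ZMod 5) r else 0 := by
    have hadd : residueSlice t (∑ r, pentagonalPart (ZMod 5) r) =
        ∑ r, residueSlice t (pentagonalPart (ZMod 5) r) := by
      ext n
      simp [coeff_residueSlice, Finset.sum_ite_irrel]
    rw [pentagonalSeries_eq_sum_pentagonalPart, hadd]
    simp only [residueSlice_pentagonalPart]
  have hsum (g : ZMod 5 → (ZMod 5)⟦X⟧) : ∑ r, g r = g 0 + g 1 + g 2 + g 3 + g 4 :=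
    Fin.sum_univ_five g
  have h0 := hslice 0
  have h1 := hslice 1
  have h2 := hslice 2
  have h3 := hslice 3
  have h4 := hslice 4
  have hid := sum_pentagonalPart_mul_pentagonalPart (ZMod 5)
  rw [hsum] at h0 h1 h2 h3 h4 hid
  generalize pentagonalSeries (ZMod 5) = f at *
  generalize pentagonalPart (ZMod 5) = K at *
  simp +decide only [if_true, if_false, zero_add, add_zero] at h0 h1 h2 h3 h4
  have hidx : (2 * 0 - 1 : ZMod 5) = 4 ∧ (2 * 1 - 1 : ZMod 5) = 1 ∧ (2 * 2 - 1 : ZMod 5) = 3 ∧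
      (2 * 3 - 1 : ZMod 5) = 0 ∧ (2 * 4 - 1 : ZMod 5) = 2 := by decide
  simp only [hidx] at hid
  have h5 : (5 : (ZMod 5)⟦X⟧) = 0 := by
    rw [← map_ofNat (C : ZMod 5 →+* (ZMod 5)⟦X⟧) 5, show (OfNat.ofNat 5 : ZMod 5) = 0 from rfl,
      map_zero]
  have hsub : (4 - 0 : ZMod 5) = 4 ∧ (4 - 1 : ZMod 5) = 3 ∧ (4 - 2 : ZMod 5) = 2 ∧
      (4 - 3 : ZMod 5) = 1 ∧ (4 - 4 : ZMod 5) = 0 ∧ (3 - 0 : ZMod 5) = 3 ∧ (3 - 1 : ZMod 5) = 2 ∧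
      (3 - 2 : ZMod 5) = 1 ∧ (3 - 3 : ZMod 5) = 0 ∧ (3 - 4 : ZMod 5) = 4 ∧
      (2 - 0 : ZMod 5) = 2 ∧ (2 - 1 : ZMod 5) = 1 ∧ (2 - 2 : ZMod 5) = 0 ∧
      (2 - 3 : ZMod 5) = 4 ∧ (2 - 4 : ZMod 5) = 3 ∧ (1 - 0 : ZMod 5) = 1 ∧
      (1 - 1 : ZMod 5) = 0 ∧ (1 - 2 : ZMod 5) = 4 ∧ (1 - 3 : ZMod 5) = 3 ∧
      (1 - 4 : ZMod 5) = 2 ∧ (0 - 0 : ZMod 5) = 0 ∧ (0 - 1 : ZMod 5) = 4 ∧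
      (0 - 2 : ZMod 5) = 3 ∧ (0 - 3 : ZMod 5) = 2 ∧ (0 - 4 : ZMod 5) = 1 := by decide
  have hmain : residueSlice (0 : ZMod 5) f * residueSlice (2 : ZMod 5) f +
      residueSlice (1 : ZMod 5) f ^ 2 = 0 := by
    rw [h0, h1, h2]
    linear_combination hid
  rw [show f ^ 4 = f * f * (f * f) by ring]
  simp only [residueSlice_mul, hsum, hsub, h3, h4]
  generalize residueSlice (0 : ZMod 5) f = A at *
  generalize residueSlice (1 : ZMod 5) f = B at *
  generalize residueSlice (2 : ZMod 5) f = C at *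
  linear_combination (A * C + B ^ 2) * hmain + (A ^ 2 * C ^ 2 + 2 * A * B ^ 2 * C) * h5

theorem five_dvd_partP (n : ℕ) : 5 ∣ partP multiplicitySet (5 * n + 4) := by
  have h5 : (5 : ZMod 5) = 0 := rfl
  have : Fact (Nat.Prime 5) := ⟨by norm_num⟩
  set f := pentagonalSeries (ZMod 5) with hf
  set P : (ZMod 5)⟦X⟧ := PowerSeries.mk fun n ↦ (partP multiplicitySet n : ZMod 5) with hP
  have hgen := mk_partP_mul_eq (ZMod 5)
  rw [← hf, ← hP] at hgen
  have hfrob : expand 5 (by norm_num) f = f ^ 5 := by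
    have h := MvPowerSeries.map_frobenius_expand 5 (by norm_num) (f := f)
    rw [ZMod.frobenius_zmod, MvPowerSeries.map_id] at h
    exact h
  have hexp (k : ℕ) (hk : k ≠ 0) : expand (5 * k) (by positivity) f =
      expand 5 (by norm_num) (expand k hk f) := expand_mul _ _ _ _ _
  have h30 : expand 30 (by norm_num) f = expand 6 (by norm_num) f ^ 5 := by
    rw [← map_pow, ← hfrob]
    exact expand_mul 6 (by norm_num) 5 (by norm_num) f
  have hcancel : P * expand 5 (by norm_num) (expand 3 (by norm_num) f * expand 2 (by norm_num) f) =
      expand 6 (by norm_num) (f ^ 4) * expand 5 (by norm_num) (expand 6 (by norm_num) f ^ 2) := by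
    apply mul_right_cancel₀ (expand_pentagonalSeries_ne_zero (ZMod 5) 6 (by norm_num))
    rw [map_mul, map_pow, map_pow, ← hexp, ← hexp, ← hexp, ← hf]
    linear_combination hgen + expand 30 (by norm_num) f ^ 2 * h30
  have hzero : residueSlice (4 : ZMod 5) (expand 6 (by norm_num) (f ^ 4)) = 0 := by
    ext m
    rw [coeff_residueSlice, map_zero, ite_eq_right_iff]
    intro hm
    by_cases h6 : 6 ∣ m
    · obtain ⟨m, rfl⟩ := h6
      rw [coeff_expand_mul]
      have h := congrArg (coeff m) residueSlice_four_pentagonalSeries_pow_four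
      rw [coeff_residueSlice, if_pos, map_zero] at h
      · exact h
      · rw [Nat.cast_mul, Nat.cast_ofNat] at hm
        linear_combination hm - (m : ZMod 5) * h5
    · exact coeff_expand_of_not_dvd _ _ _ h6
  have hslice : residueSlice (4 : ZMod 5) P = 0 := by
    have h := congrArg (residueSlice (4 : ZMod 5)) hcancel
    rw [residueSlice_expand_mul, residueSlice_expand_mul, hzero, zero_mul, map_mul, ← hexp, ← hexp] at h
    exact (mul_eq_zero.mp h).resolve_right (mul_ne_zero
      (expand_pentagonalSeries_ne_zero _ _ _) (expand_pentagonalSeries_ne_zero _ _ _))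
  have h := congrArg (coeff (5 * n + 4)) hslice
  rw [coeff_residueSlice, if_pos, map_zero, coeff_mk] at h
  · exact (ZMod.natCast_eq_zero_iff _ _).mp h
  · push_cast
    linear_combination (n : ZMod 5) * h5

end RamanujanCongruence

/-- Explicit example with moduli (2,3,5) and Ramanujan's congruence mod 5. -/
theorem example_2_3_5 :
    (∀ n : ℕ,
      partP ({6, 10, 12, 15, 16, 18, 20, 21, 22, 24, 25, 26, 27, 28, 31, 32, 33,
          34, 35, 37, 38, 39, 41, 43, 44, 47, 49, 53, 59} : Set ℕ) n
        = partQ {b : ℕ | b % 30 = 6 ∨ b % 30 = 10 ∨ b % 30 = 12 ∨ b % 30 = 15 ∨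
            b % 30 = 18 ∨ b % 30 = 20 ∨ b % 30 = 24} n) ∧
    (∀ n : ℕ, 5 ∣ partP ({6, 10, 12, 15, 16, 18, 20, 21, 22, 24, 25, 26, 27, 28,
        31, 32, 33, 34, 35, 37, 38, 39, 41, 43, 44, 47, 49, 53, 59} : Set ℕ) (5 * n + 4)) := by
  exact ⟨partP_eq_partQ, five_dvd_partP⟩
end
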